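/- Let g be holomorphic on 𝔻 with g ∈ BMOA \ VMOA_log. Then there exists a function F ∈ BMOA such that T_g F ∈ BMOA \ VMOA. -/

import Mathlib

open Complex MeasureTheory Set Filter

noncomputable section

/-- The open unit disc in the complex plane. -/
def unitDisc : Set ℂ := Metric.ball 0 1

/-- The Möbius involution `φ_a(z) = (a - z)/(1 - conj(a) z)`. -/
def mobius (a z : ℂ) : ℂ := (a - z) / (1 - (starRingEnd ℂ) a * z)

/-- The hyperbolic distance on the unit disc. -/
def hypDist (a z : ℂ) : ℝ :=
  (1 / 2) * Real.log ((1 + ‖mobius a z‖) / (1 - ‖mobius a z‖))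

/-- The `BMOA` Garsia-type seminorm squared at the point `a`, with normalized
area measure `dm = dx dy / π`. -/
def bmoaSemi (f : ℂ → ℂ) (a : ℂ) : ℝ :=
  (Real.pi)⁻¹ * ∫ z in unitDisc, ‖deriv f z‖ ^ 2 * (1 - ‖mobius a z‖ ^ 2)

/-- `f` is an analytic function of bounded mean oscillation. -/
def IsBMOA (f : ℂ → ℂ) : Prop :=
  DifferentiableOn ℂ f unitDisc ∧ ∃ C : ℝ, ∀ a ∈ unitDisc, bmoaSemi f a ≤ C

/-- `f` is an analytic function of vanishing mean oscillation. -/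
def IsVMOA (f : ℂ → ℂ) : Prop :=
  IsBMOA f ∧ ∀ ε > 0, ∃ r < 1, ∀ a ∈ unitDisc, r < ‖a‖ → bmoaSemi f a < ε

/-- The Bloch quantity `|f'(z)| (1 - |z|²)`. -/
def blochSemi (f : ℂ → ℂ) (z : ℂ) : ℝ := ‖deriv f z‖ * (1 - ‖z‖ ^ 2)

/-- `f` belongs to the Bloch space. -/
def IsBloch (f : ℂ → ℂ) : Prop :=
  DifferentiableOn ℂ f unitDisc ∧ ∃ C : ℝ, ∀ z ∈ unitDisc, blochSemi f z ≤ C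

/-- `f` belongs to the little Bloch space. -/
def IsLittleBloch (f : ℂ → ℂ) : Prop :=
  IsBloch f ∧ ∀ ε > 0, ∃ r < 1, ∀ z ∈ unitDisc, r < ‖z‖ → blochSemi f z < ε

/-- The `BMOA` norm `|f(0)| + ‖f‖_*`. -/
def bmoaNorm (f : ℂ → ℂ) : ℝ :=
  ‖f 0‖ + Real.sqrt (⨆ a : unitDisc, bmoaSemi f (a : ℂ))

/-- The Bloch norm `|f(0)| + sup_z |f'(z)|(1-|z|²)`. -/
def blochNorm (f : ℂ → ℂ) : ℝ :=
  ‖f 0‖ + ⨆ z : unitDisc, blochSemi f (z : ℂ)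

/-- `φ` is a semigroup of holomorphic self-maps of the unit disc. -/
def IsHoloSemigroup (φ : ℝ → ℂ → ℂ) : Prop :=
  (∀ t : ℝ, 0 ≤ t → DifferentiableOn ℂ (φ t) unitDisc ∧ MapsTo (φ t) unitDisc unitDisc) ∧
  (∀ z ∈ unitDisc, φ 0 z = z) ∧
  (∀ t : ℝ, 0 ≤ t → ∀ s : ℝ, 0 ≤ s → ∀ z ∈ unitDisc, φ (t + s) z = φ t (φ s z)) ∧
  (∀ K ⊆ unitDisc, IsCompact K →
    TendstoUniformlyOn (fun t z => φ t z) id (nhdsWithin 0 (Ioi 0)) K)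

/-- The maximal subspace of strong continuity `[φ_t, BMOA]`. -/
def maxSubspaceBMOA (φ : ℝ → ℂ → ℂ) : Set (ℂ → ℂ) :=
  {f | IsBMOA f ∧
    Tendsto (fun t => bmoaNorm (fun z => f (φ t z) - f z)) (nhdsWithin 0 (Ioi 0)) (nhds 0)}

/-- The maximal subspace of strong continuity `[φ_t, 𝓑]`. -/
def maxSubspaceBloch (φ : ℝ → ℂ → ℂ) : Set (ℂ → ℂ) :=
  {f | IsBloch f ∧
    Tendsto (fun t => blochNorm (fun z => f (φ t z) - f z)) (nhdsWithin 0 (Ioi 0)) (nhds 0)}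

/-- `G` is the infinitesimal generator of the semigroup `φ`. -/
def IsGenerator (φ : ℝ → ℂ → ℂ) (G : ℂ → ℂ) : Prop :=
  DifferentiableOn ℂ G unitDisc ∧
  ∀ z ∈ unitDisc,
    Tendsto (fun t : ℝ => (φ t z - z) / (t : ℂ)) (nhdsWithin 0 (Ioi 0)) (nhds (G z))

/-- The semigroup is elliptic: its Denjoy–Wolff point lies in the disc. -/
def IsElliptic (φ : ℝ → ℂ → ℂ) : Prop :=
  ∃ τ ∈ unitDisc, ∀ t : ℝ, 0 ≤ t → φ t τ = τ

/-- The logarithmic vanishing Bloch condition (LVB) on a generator `G`. -/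
def LVB (G : ℂ → ℂ) : Prop :=
  ∀ ε > 0, ∃ r < 1, ∀ z ∈ unitDisc, r < ‖z‖ →
    (1 - ‖z‖ ^ 2) / ‖G z‖ * Real.log (1 / (1 - ‖z‖ ^ 2)) < ε

/-- The logarithmic vanishing mean oscillation condition (LVMO) on a generator `G`. -/
def LVMO (G : ℂ → ℂ) : Prop :=
  ∀ ε > 0, ∃ r < 1, ∀ a ∈ unitDisc, r < ‖a‖ →
    (Real.log (Real.exp 1 / (1 - ‖a‖ ^ 2))) ^ 2 *
      ((Real.pi)⁻¹ * ∫ z in unitDisc, (1 - ‖mobius a z‖ ^ 2) / ‖G z‖ ^ 2) < ε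

/-- `f` belongs to the logarithmic little Bloch space `𝓑_{log,0}`. -/
def InBlochLog0 (f : ℂ → ℂ) : Prop :=
  ∀ ε > 0, ∃ r < 1, ∀ z ∈ unitDisc, r < ‖z‖ →
    ‖deriv f z‖ * (1 - ‖z‖ ^ 2) * Real.log (Real.exp 1 / (1 - ‖z‖ ^ 2)) < ε

/-- `f` belongs to `VMOA_log`. -/
def InVMOAlog (f : ℂ → ℂ) : Prop :=
  ∀ ε > 0, ∃ r < 1, ∀ a ∈ unitDisc, r < ‖a‖ →
    (Real.log (Real.exp 1 / (1 - ‖a‖ ^ 2))) ^ 2 * bmoaSemi f a < ε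

/-- Hyperbolic midpoint of the segment `[0, w]`. -/
def wstar (w : ℂ) : ℂ :=
  (((1 - Real.sqrt (1 - ‖w‖ ^ 2)) / ‖w‖ ^ 2 : ℝ) : ℂ) * w

/-- The building-block function `β_w(z) = Log(e / (1 + conj(w) φ_{w*}(z)))`. -/
def betaB (w z : ℂ) : ℂ :=
  Complex.log ((Real.exp 1 : ℂ) / (1 + (starRingEnd ℂ) w * mobius (wstar w) z))

/-- The (invariant) Carleson box `S(I_u)` associated with a point `u ∈ 𝔻 \ {0}`. -/
def carlesonBox (u : ℂ) : Set ℂ :=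
  {z ∈ unitDisc | ((starRingEnd ℂ) u * mobius u z).re ≤ 0}

/-- The generalized Volterra operator `T_g f(z) = ∫₀^z f(ζ) g'(ζ) dζ`. -/
def volterra (g f : ℂ → ℂ) (z : ℂ) : ℂ :=
  z * ∫ t in (0:ℝ)..1, f ((t : ℂ) * z) * deriv g ((t : ℂ) * z)

/-! ### Weighted `L²` norms over the disc -/

/-- The measure `(1 - |φ_a(z)|²) dx dy` on the unit disc. -/
def garsiaMeasure (a : ℂ) : Measure ℂ :=
  (volume.restrict unitDisc).withDensity fun z => ENNReal.ofReal (1 - ‖mobius a z‖ ^ 2)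

/-- The `L²` norm with respect to the measure `(1 - |φ_a(z)|²) dx dy` on the unit disc. -/
def garsiaNorm (h : ℂ → ℂ) (a : ℂ) : ENNReal := eLpNorm h 2 (garsiaMeasure a)

lemma isOpen_unitDisc : IsOpen unitDisc := Metric.isOpen_ball

lemma mem_unitDisc {z : ℂ} : z ∈ unitDisc ↔ ‖z‖ < 1 := by simp [unitDisc]

lemma measurable_mobius_weight (a : ℂ) :
    Measurable fun z => ENNReal.ofReal (1 - ‖mobius a z‖ ^ 2) := by
  unfold mobius
  fun_prop

lemma garsiaNorm_sq (h : ℂ → ℂ) (a : ℂ) :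
    garsiaNorm h a ^ 2 =
      ∫⁻ z in unitDisc, ENNReal.ofReal (‖h z‖ ^ 2 * (1 - ‖mobius a z‖ ^ 2)) := by
  have h1 := eLpNorm_nnreal_pow_eq_lintegral (f := h) (μ := garsiaMeasure a) (p := 2) (by norm_num)
  have h2 : garsiaNorm h a ^ 2 = ∫⁻ z, ‖h z‖ₑ ^ 2 ∂garsiaMeasure a := by
    simpa [garsiaNorm] using h1
  rw [h2, garsiaMeasure, lintegral_withDensity_eq_lintegral_mul_non_measurable _
    (measurable_mobius_weight a) (by simp)]
  refine lintegral_congr fun z => ?_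
  rw [ENNReal.ofReal_mul (by positivity), ENNReal.ofReal_pow (by positivity), ofReal_norm]
  simp [mul_comm]

lemma one_sub_conj_mul_ne_zero {a z : ℂ} (ha : ‖a‖ < 1) (hz : ‖z‖ < 1) :
    1 - (starRingEnd ℂ) a * z ≠ 0 := by
  intro h
  have h1 : ‖(starRingEnd ℂ) a * z‖ = 1 := by rw [← sub_eq_zero.mp h, norm_one]
  rw [norm_mul, RCLike.norm_conj] at h1
  nlinarith [norm_nonneg a, norm_nonneg z]

lemma one_sub_norm_le_norm_one_sub {a z : ℂ} (hz : ‖z‖ < 1) :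
    1 - ‖a‖ ≤ ‖1 - (starRingEnd ℂ) a * z‖ := by
  have h1 := norm_sub_norm_le 1 ((starRingEnd ℂ) a * z)
  rw [norm_mul, RCLike.norm_conj, norm_one] at h1
  nlinarith [norm_nonneg a, norm_nonneg z]

lemma one_sub_norm_le_norm_one_sub' {a z : ℂ} (ha : ‖a‖ < 1) :
    1 - ‖z‖ ≤ ‖1 - (starRingEnd ℂ) a * z‖ := by
  have h1 := norm_sub_norm_le 1 ((starRingEnd ℂ) a * z)
  rw [norm_mul, RCLike.norm_conj, norm_one] at h1
  nlinarith [norm_nonneg a, norm_nonneg z]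

lemma norm_one_sub_le_two {a z : ℂ} (ha : ‖a‖ < 1) (hz : ‖z‖ < 1) :
    ‖1 - (starRingEnd ℂ) a * z‖ ≤ 2 := by
  have h1 := norm_sub_le 1 ((starRingEnd ℂ) a * z)
  rw [norm_mul, RCLike.norm_conj, norm_one] at h1
  nlinarith [norm_nonneg a, norm_nonneg z]

lemma norm_one_sub_pos {a z : ℂ} (ha : ‖a‖ < 1) (hz : ‖z‖ < 1) :
    0 < ‖1 - (starRingEnd ℂ) a * z‖ :=
  norm_pos_iff.mpr (one_sub_conj_mul_ne_zero ha hz)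

lemma one_sub_norm_mobius_sq {a z : ℂ} (ha : ‖a‖ < 1) (hz : ‖z‖ < 1) :
    1 - ‖mobius a z‖ ^ 2 =
      (1 - ‖a‖ ^ 2) * (1 - ‖z‖ ^ 2) / ‖1 - (starRingEnd ℂ) a * z‖ ^ 2 := by
  have h0 := norm_one_sub_pos ha hz
  have key : ‖1 - (starRingEnd ℂ) a * z‖ ^ 2 - ‖a - z‖ ^ 2 =
      (1 - ‖a‖ ^ 2) * (1 - ‖z‖ ^ 2) := by
    simp only [← Complex.normSq_eq_norm_sq, Complex.normSq_apply, Complex.sub_re, Complex.sub_im,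
      Complex.mul_re, Complex.mul_im, Complex.conj_re, Complex.conj_im, Complex.one_re,
      Complex.one_im]
    ring
  rw [mobius, norm_div, div_pow, ← key, sub_div, div_self (pow_pos h0 2).ne']

lemma one_sub_norm_mobius_sq_nonneg {a z : ℂ} (ha : ‖a‖ < 1) (hz : ‖z‖ < 1) :
    0 ≤ 1 - ‖mobius a z‖ ^ 2 := by
  rw [one_sub_norm_mobius_sq ha hz]
  have h1 : 0 ≤ 1 - ‖a‖ ^ 2 := by nlinarith [norm_nonneg a]
  have h2 : 0 ≤ 1 - ‖z‖ ^ 2 := by nlinarith [norm_nonneg z]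
  positivity

lemma garsiaMeasure_absolutelyContinuous (a : ℂ) :
    garsiaMeasure a ≪ volume.restrict unitDisc :=
  withDensity_absolutelyContinuous _ _

lemma aestronglyMeasurable_of_continuousOn_unitDisc {h : ℂ → ℂ} (hh : ContinuousOn h unitDisc)
    (a : ℂ) : AEStronglyMeasurable h (garsiaMeasure a) :=
  (hh.aestronglyMeasurable isOpen_unitDisc.measurableSet).mono_ac
    (garsiaMeasure_absolutelyContinuous a)

lemma garsiaNorm_le_add {h k l : ℂ → ℂ} {a b e : ℂ} {c d : ℝ} (hc : 0 ≤ c) (hd : 0 ≤ d)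
    (hk : ContinuousOn k unitDisc)
    (H : ∀ z ∈ unitDisc, ‖h z‖ ^ 2 * (1 - ‖mobius a z‖ ^ 2) ≤
      c ^ 2 * (‖k z‖ ^ 2 * (1 - ‖mobius b z‖ ^ 2)) +
        d ^ 2 * (‖l z‖ ^ 2 * (1 - ‖mobius e z‖ ^ 2))) :
    garsiaNorm h a ≤ ENNReal.ofReal c * garsiaNorm k b + ENNReal.ofReal d * garsiaNorm l e := by
  have hm : AEMeasurable
      (fun z => ENNReal.ofReal (c ^ 2 * (‖k z‖ ^ 2 * (1 - ‖mobius b z‖ ^ 2))))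
      (volume.restrict unitDisc) := by
    have h1 : AEMeasurable k (volume.restrict unitDisc) :=
      (hk.aestronglyMeasurable isOpen_unitDisc.measurableSet).aemeasurable
    have h2 : Measurable (mobius b) := by unfold mobius; fun_prop
    fun_prop
  have h1 : garsiaNorm h a ^ 2 ≤
      (ENNReal.ofReal c * garsiaNorm k b) ^ 2 + (ENNReal.ofReal d * garsiaNorm l e) ^ 2 := by
    rw [mul_pow, mul_pow, garsiaNorm_sq, garsiaNorm_sq, garsiaNorm_sq, ← ENNReal.ofReal_pow hc,
      ← ENNReal.ofReal_pow hd, ← lintegral_const_mul' _ _ ENNReal.ofReal_ne_top,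
      ← lintegral_const_mul' _ _ ENNReal.ofReal_ne_top]
    simp_rw [← ENNReal.ofReal_mul (sq_nonneg c), ← ENNReal.ofReal_mul (sq_nonneg d)]
    rw [← lintegral_add_left' hm]
    refine setLIntegral_mono_ae' isOpen_unitDisc.measurableSet (ae_of_all _ fun z hz => ?_)
    exact (ENNReal.ofReal_le_ofReal (H z hz)).trans ENNReal.ofReal_add_le
  have h2 : garsiaNorm h a ^ 2 ≤
      (ENNReal.ofReal c * garsiaNorm k b + ENNReal.ofReal d * garsiaNorm l e) ^ 2 := by
    refine h1.trans ?_
    rw [add_sq]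
    gcongr
    exact le_self_add
  exact (ENNReal.pow_le_pow_left_iff two_ne_zero).mp h2

lemma garsiaNorm_le_mul {h k : ℂ → ℂ} {a b : ℂ} {c : ℝ} (hc : 0 ≤ c)
    (H : ∀ z ∈ unitDisc, ‖h z‖ ^ 2 * (1 - ‖mobius a z‖ ^ 2) ≤
      c ^ 2 * (‖k z‖ ^ 2 * (1 - ‖mobius b z‖ ^ 2))) :
    garsiaNorm h a ≤ ENNReal.ofReal c * garsiaNorm k b := by
  have h1 := garsiaNorm_le_add (h := h) (k := 0) (l := k) (a := a) (b := b) (e := b) le_rfl hc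
    continuousOn_const (by simpa using H)
  simpa using h1

lemma garsiaNorm_le_mul_of_norm_le {h k : ℂ → ℂ} {a : ℂ} (ha : ‖a‖ < 1) {c : ℝ} (hc : 0 ≤ c)
    (H : ∀ z ∈ unitDisc, ‖h z‖ ≤ c * ‖k z‖) :
    garsiaNorm h a ≤ ENNReal.ofReal c * garsiaNorm k a := by
  refine garsiaNorm_le_mul hc fun z hz => ?_
  rw [← mul_assoc, ← mul_pow]
  exact mul_le_mul_of_nonneg_right (pow_le_pow_left₀ (norm_nonneg _) (H z hz) 2)
    (one_sub_norm_mobius_sq_nonneg ha (mem_unitDisc.mp hz))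

lemma garsiaNorm_congr {h k : ℂ → ℂ} (H : EqOn h k unitDisc) (a : ℂ) :
    garsiaNorm h a = garsiaNorm k a :=
  eLpNorm_congr_ae <| (garsiaMeasure_absolutelyContinuous a).ae_le <|
    (ae_restrict_iff' isOpen_unitDisc.measurableSet).mpr (ae_of_all _ H)

lemma garsiaNorm_zero (a : ℂ) : garsiaNorm 0 a = 0 := by simp [garsiaNorm]

lemma garsiaNorm_le_tsum {h : ℂ → ℂ} {H : ℕ → ℂ → ℂ} (hH : ∀ n, ContinuousOn (H n) unitDisc)
    (hs : ∀ z ∈ unitDisc, HasSum (fun n => H n z) (h z)) (a : ℂ) :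
    garsiaNorm h a ≤ ∑' n, garsiaNorm (H n) a := by
  have hm := fun n => aestronglyMeasurable_of_continuousOn_unitDisc (hH n) a
  have hlim : ∀ᵐ z ∂garsiaMeasure a,
      Tendsto (fun n => (∑ i ∈ Finset.range n, H i) z) atTop (nhds (h z)) := by
    refine (garsiaMeasure_absolutelyContinuous a).ae_le ?_
    refine (ae_restrict_iff' isOpen_unitDisc.measurableSet).mpr (ae_of_all _ fun z hz => ?_)
    simpa [Finset.sum_apply] using (hs z hz).tendsto_sum_nat
  refine Lp.eLpNorm_le_of_ae_tendsto (Eventually.of_forall fun n => ?_)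
    (fun n => Finset.aestronglyMeasurable_sum _ fun i _ => hm i) hlim
  exact (eLpNorm_sum_le (fun i _ => hm i) (by norm_num)).trans (ENNReal.sum_le_tsum _)

lemma garsiaNorm_add_le {h k : ℂ → ℂ} (hh : ContinuousOn h unitDisc)
    (hk : ContinuousOn k unitDisc) (a : ℂ) :
    garsiaNorm (h + k) a ≤ garsiaNorm h a + garsiaNorm k a :=
  eLpNorm_add_le (aestronglyMeasurable_of_continuousOn_unitDisc hh a)
    (aestronglyMeasurable_of_continuousOn_unitDisc hk a) (by norm_num)

lemma continuousOn_deriv_unitDisc {f : ℂ → ℂ} (hf : DifferentiableOn ℂ f unitDisc) :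
    ContinuousOn (deriv f) unitDisc :=
  (hf.deriv isOpen_unitDisc).continuousOn

lemma bmoaSemi_eq {f : ℂ → ℂ} (hf : ContinuousOn (deriv f) unitDisc) {a : ℂ} (ha : ‖a‖ < 1) :
    bmoaSemi f a = Real.pi⁻¹ * (garsiaNorm (deriv f) a ^ 2).toReal := by
  have h2 : Measurable (mobius a) := by unfold mobius; fun_prop
  have h1 : AEStronglyMeasurable (deriv f) (volume.restrict unitDisc) :=
    hf.aestronglyMeasurable isOpen_unitDisc.measurableSet
  rw [garsiaNorm_sq, bmoaSemi, integral_eq_lintegral_of_nonneg_ae]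
  · refine (ae_restrict_iff' isOpen_unitDisc.measurableSet).mpr (ae_of_all _ fun z hz => ?_)
    exact mul_nonneg (sq_nonneg _) (one_sub_norm_mobius_sq_nonneg ha (mem_unitDisc.mp hz))
  · exact (h1.norm.pow 2).mul (by fun_prop)

/-! ### Integral estimates for kernels -/

lemma integrable_and_integral_radial_kernel {δ : ℝ} (hδ : 0 < δ) :
    IntegrableOn (fun t : ℝ => δ / (δ + t) ^ 2) (Ioi 0) ∧
      ∫ t in Ioi (0 : ℝ), δ / (δ + t) ^ 2 = 1 := by
  have hd : ∀ t ∈ Ici (0 : ℝ), HasDerivAt (fun t : ℝ => -δ / (δ + t)) (δ / (δ + t) ^ 2) t := by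
    intro t ht
    have h0 : δ + t ≠ 0 := (add_pos_of_pos_of_nonneg hδ ht).ne'
    have h1 := (hasDerivAt_const t (-δ)).div ((hasDerivAt_id t).const_add δ) h0
    convert! h1 using 1
    simp
  have hp : ∀ t ∈ Ioi (0 : ℝ), 0 ≤ δ / (δ + t) ^ 2 := fun t _ => by positivity
  have hl : Tendsto (fun t : ℝ => -δ / (δ + t)) atTop (nhds 0) :=
    (tendsto_const_nhds (x := -δ)).div_atTop (tendsto_atTop_add_const_left _ δ tendsto_id)
  refine ⟨integrableOn_Ioi_deriv_of_nonneg' hd hp hl, ?_⟩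
  rw [integral_Ioi_of_hasDerivAt_of_nonneg' hd hp hl, add_zero, neg_div, div_self hδ.ne']
  norm_num

lemma lintegral_radial_kernel {δ : ℝ} (hδ : 0 < δ) :
    ∫⁻ u : ℂ, ENNReal.ofReal (δ / (‖u‖ * (δ + ‖u‖) ^ 2)) = ENNReal.ofReal (2 * Real.pi) := by
  obtain ⟨hi, hI⟩ := integrable_and_integral_radial_kernel hδ
  have hcongr : EqOn (fun y : ℝ => y ^ (Module.finrank ℝ ℂ - 1) • (δ / (y * (δ + y) ^ 2)))
      (fun t : ℝ => δ / (δ + t) ^ 2) (Ioi 0) := by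
    intro y hy
    have hy' : y ≠ 0 := (mem_Ioi.mp hy).ne'
    have : δ + y ≠ 0 := (add_pos hδ hy).ne'
    simp only [Complex.finrank_real_complex, smul_eq_mul]
    norm_num
    field_simp
  have hint : Integrable (fun u : ℂ => δ / (‖u‖ * (δ + ‖u‖) ^ 2)) := by
    refine (integrable_fun_norm_addHaar volume (E := ℂ)
      (f := fun y => δ / (y * (δ + y) ^ 2))).mpr ?_
    exact hi.congr_fun hcongr.symm measurableSet_Ioi
  rw [← ofReal_integral_eq_lintegral_ofReal hint (ae_of_all _ fun u => by positivity)]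
  congr 1
  rw [integral_fun_norm_addHaar volume (fun y : ℝ => δ / (y * (δ + y) ^ 2)),
    setIntegral_congr_fun measurableSet_Ioi hcongr, hI]
  simp [Measure.real, Complex.volume_ball]

/-- The kernel `δ / (s (δ + s)²)` in the variable `s = |1 - conj(w) z|`. -/
def pointKernel (δ : ℝ) (w z : ℂ) : ℝ :=
  δ / (‖1 - (starRingEnd ℂ) w * z‖ * (δ + ‖1 - (starRingEnd ℂ) w * z‖) ^ 2)

lemma pointKernel_nonneg {δ : ℝ} (hδ : 0 ≤ δ) (w z : ℂ) : 0 ≤ pointKernel δ w z := by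
  unfold pointKernel
  positivity

lemma measurable_pointKernel (δ : ℝ) (w : ℂ) : Measurable (pointKernel δ w) := by
  unfold pointKernel
  fun_prop

lemma lintegral_pointKernel_le {δ : ℝ} (hδ : 0 < δ) {w : ℂ} (hw : 1 / 2 ≤ ‖w‖) :
    ∫⁻ z in unitDisc, ENNReal.ofReal (pointKernel δ w z) ≤ ENNReal.ofReal (16 * Real.pi) := by
  have hc : (starRingEnd ℂ) w ≠ 0 := by
    intro h
    rw [← RCLike.norm_conj, h, norm_zero] at hw
    norm_num at hw
  have hpt : ∀ z, pointKernel δ w z ≤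
      8 * (δ / (‖z - ((starRingEnd ℂ) w)⁻¹‖ * (δ + ‖z - ((starRingEnd ℂ) w)⁻¹‖) ^ 2)) := by
    intro z
    have hs : ‖1 - (starRingEnd ℂ) w * z‖ = ‖w‖ * ‖z - ((starRingEnd ℂ) w)⁻¹‖ := by
      rw [← RCLike.norm_conj w, ← norm_mul, mul_sub, mul_inv_cancel₀ hc, norm_sub_rev]
    unfold pointKernel
    rw [hs]
    set t := ‖z - ((starRingEnd ℂ) w)⁻¹‖ with ht
    have ht0 : 0 ≤ t := norm_nonneg _
    rcases ht0.eq_or_lt with h0 | h0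
    · simp [← h0]
    have h1 : t / 2 ≤ ‖w‖ * t := by nlinarith
    have h2 : (δ + t) / 2 ≤ δ + ‖w‖ * t := by linarith
    calc δ / (‖w‖ * t * (δ + ‖w‖ * t) ^ 2)
        ≤ δ / (t / 2 * ((δ + t) / 2) ^ 2) := by gcongr
      _ = 8 * (δ / (t * (δ + t) ^ 2)) := by field_simp; norm_num
  calc ∫⁻ z in unitDisc, ENNReal.ofReal (pointKernel δ w z)
      ≤ ∫⁻ z : ℂ, ENNReal.ofReal (pointKernel δ w z) := setLIntegral_le_lintegral _ _
    _ ≤ ∫⁻ z : ℂ, ENNReal.ofReal 8 * ENNReal.ofReal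
        (δ / (‖z - ((starRingEnd ℂ) w)⁻¹‖ * (δ + ‖z - ((starRingEnd ℂ) w)⁻¹‖) ^ 2)) := by
        refine lintegral_mono fun z => ?_
        rw [← ENNReal.ofReal_mul (by norm_num)]
        exact ENNReal.ofReal_le_ofReal (hpt z)
    _ = ENNReal.ofReal (16 * Real.pi) := by
        rw [lintegral_const_mul' _ _ ENNReal.ofReal_ne_top,
          lintegral_sub_right_eq_self
            (fun u : ℂ => ENNReal.ofReal (δ / (‖u‖ * (δ + ‖u‖) ^ 2))),
          lintegral_radial_kernel hδ, ← ENNReal.ofReal_mul (by norm_num)]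
        congr 1
        ring

lemma le_kernel_of_le {δ s x : ℝ} (hδ : 0 < δ) (hs : δ ≤ s) (hsx : s ≤ x) :
    δ * s / (x ^ 2 * s ^ 2) ≤ 4 * (δ / (s * (δ + s) ^ 2)) := by
  have hs0 : 0 < s := hδ.trans_le hs
  have hx0 : 0 < x := hs0.trans_le hsx
  have : δ + s ≤ 2 * s := by linarith
  calc δ * s / (x ^ 2 * s ^ 2) ≤ δ * s / (s ^ 2 * s ^ 2) := by gcongr
    _ = 4 * (δ / (s * (2 * s) ^ 2)) := by field_simp; norm_num
    _ ≤ 4 * (δ / (s * (δ + s) ^ 2)) := by gcongr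

lemma le_kernel_of_ge {δ s x : ℝ} (hδ : 0 < δ) (hs : 0 < s) (hx : δ ≤ x) (hsx : s ≤ x) :
    δ * s / (s ^ 2 * x ^ 2) ≤ 4 * (δ / (s * (δ + s) ^ 2)) := by
  have hx0 : 0 < x := hδ.trans_le hx
  have : δ + s ≤ 2 * x := by linarith
  calc δ * s / (s ^ 2 * x ^ 2) = 4 * (δ / (s * (2 * x) ^ 2)) := by field_simp; norm_num
    _ ≤ 4 * (δ / (s * (δ + s) ^ 2)) := by gcongr

lemma kernel_mul_mobius_weight_le {a w z : ℂ} (ha : ‖a‖ < 1) (hw : ‖w‖ < 1) (hz : ‖z‖ < 1) :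
    (‖1 - (starRingEnd ℂ) w * z‖⁻¹) ^ 2 * (1 - ‖mobius a z‖ ^ 2) ≤
      16 * (pointKernel (1 - ‖a‖) w z + pointKernel (1 - ‖a‖) a z) := by
  rw [one_sub_norm_mobius_sq ha hz]
  have hs := norm_one_sub_pos hw hz
  have hx := norm_one_sub_pos ha hz
  have hs1 := one_sub_norm_le_norm_one_sub' (z := z) hw
  have hx1 := one_sub_norm_le_norm_one_sub (a := a) hz
  have hx2 := one_sub_norm_le_norm_one_sub' (z := z) ha
  have hk1 := pointKernel_nonneg (sub_pos.mpr ha).le w z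
  have hk2 := pointKernel_nonneg (sub_pos.mpr ha).le a z
  unfold pointKernel at *
  set s := ‖1 - (starRingEnd ℂ) w * z‖
  set x := ‖1 - (starRingEnd ℂ) a * z‖
  have hδ : 0 < 1 - ‖a‖ := sub_pos.mpr ha
  have h1 : 1 - ‖a‖ ^ 2 ≤ 2 * (1 - ‖a‖) := by nlinarith [norm_nonneg a]
  have h2 : 1 - ‖z‖ ^ 2 ≤ 2 * (1 - ‖z‖) := by nlinarith [norm_nonneg z]
  have h3 : 0 ≤ 1 - ‖z‖ := by linarith
  have h4 : ∀ m, 1 - ‖z‖ ≤ m → s⁻¹ ^ 2 * ((1 - ‖a‖ ^ 2) * (1 - ‖z‖ ^ 2) / x ^ 2) ≤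
      4 * ((1 - ‖a‖) * m / (s ^ 2 * x ^ 2)) := by
    intro m hm
    have h5 : (1 - ‖a‖ ^ 2) * (1 - ‖z‖ ^ 2) ≤ (2 * (1 - ‖a‖)) * (2 * m) := by
      refine mul_le_mul h1 (by linarith) ?_ (by linarith)
      nlinarith [norm_nonneg z]
    calc s⁻¹ ^ 2 * ((1 - ‖a‖ ^ 2) * (1 - ‖z‖ ^ 2) / x ^ 2)
        ≤ s⁻¹ ^ 2 * ((2 * (1 - ‖a‖)) * (2 * m) / x ^ 2) := by gcongr
      _ = 4 * ((1 - ‖a‖) * m / (s ^ 2 * x ^ 2)) := by field_simp; ring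
  rcases le_total s x with h | h
  · have := le_kernel_of_ge hδ hs hx1 h
    linarith [h4 s hs1]
  · have := le_kernel_of_le hδ hx1 h
    linarith [h4 x hx2]

lemma kernel_mul_mobius_weight_le_of_norm_le {a w z : ℂ} (ha : ‖a‖ ≤ 1 / 2) (hw : ‖w‖ < 1)
    (hz : ‖z‖ < 1) :
    (‖1 - (starRingEnd ℂ) w * z‖⁻¹) ^ 2 * (1 - ‖mobius a z‖ ^ 2) ≤
      144 * pointKernel (1 - ‖a‖) w z := by
  have ha1 : ‖a‖ < 1 := by linarith
  rw [one_sub_norm_mobius_sq ha1 hz]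
  have hs := norm_one_sub_pos hw hz
  have hs1 := one_sub_norm_le_norm_one_sub' (z := z) hw
  have hs2 := norm_one_sub_le_two hw hz
  have hx1 := one_sub_norm_le_norm_one_sub (a := a) hz
  unfold pointKernel
  set s := ‖1 - (starRingEnd ℂ) w * z‖
  set x := ‖1 - (starRingEnd ℂ) a * z‖
  have hx : 1 / 2 ≤ x := by linarith
  have h1 : 1 - ‖a‖ ^ 2 ≤ 1 := by nlinarith [norm_nonneg a]
  have h2 : 1 - ‖z‖ ^ 2 ≤ 2 * s := by nlinarith [norm_nonneg z]
  have h3 : 0 ≤ 1 - ‖z‖ ^ 2 := by nlinarith [norm_nonneg z]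
  have h4 : 1 / 2 ≤ 1 - ‖a‖ := by linarith
  have h5 : 1 - ‖a‖ + s ≤ 3 := by linarith [norm_nonneg a]
  have h6 : 0 ≤ 1 - ‖a‖ := by linarith
  calc s⁻¹ ^ 2 * ((1 - ‖a‖ ^ 2) * (1 - ‖z‖ ^ 2) / x ^ 2)
      ≤ s⁻¹ ^ 2 * (1 * (2 * s) / (1 / 2) ^ 2) := by gcongr
    _ = 144 * ((1 / 2) / (s * 3 ^ 2)) := by field_simp; norm_num
    _ ≤ 144 * ((1 - ‖a‖) / (s * (1 - ‖a‖ + s) ^ 2)) := by gcongr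

/-- The functions `1 / (1 - conj(w) z)` are derivatives of a bounded family in `BMOA`. -/
lemma exists_garsiaNorm_kernel_le : ∃ C : ℝ, 0 < C ∧ ∀ a w : ℂ, ‖a‖ < 1 → 1 / 2 ≤ ‖w‖ → ‖w‖ < 1 →
    garsiaNorm (fun z => (1 - (starRingEnd ℂ) w * z)⁻¹) a ≤ ENNReal.ofReal C := by
  refine ⟨√(144 * (32 * Real.pi)), by positivity, fun a w ha hw hw1 => ?_⟩
  rw [← ENNReal.pow_le_pow_left_iff two_ne_zero, ← ENNReal.ofReal_pow (by positivity),
    Real.sq_sqrt (by positivity), garsiaNorm_sq]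
  simp_rw [norm_inv]
  have hδ : 0 < 1 - ‖a‖ := sub_pos.mpr ha
  have hbound : ∀ K : ℂ → ℝ, (∀ z ∈ unitDisc, (‖1 - (starRingEnd ℂ) w * z‖⁻¹) ^ 2 *
      (1 - ‖mobius a z‖ ^ 2) ≤ 144 * K z) →
      ∫⁻ z in unitDisc, ENNReal.ofReal (K z) ≤ ENNReal.ofReal (32 * Real.pi) →
      ∫⁻ z in unitDisc, ENNReal.ofReal ((‖1 - (starRingEnd ℂ) w * z‖⁻¹) ^ 2 *
        (1 - ‖mobius a z‖ ^ 2)) ≤ ENNReal.ofReal (144 * (32 * Real.pi)) := by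
    intro K hK hI
    rw [ENNReal.ofReal_mul (by norm_num)]
    refine le_trans ?_ (mul_le_mul_right hI _)
    rw [← lintegral_const_mul' _ _ ENNReal.ofReal_ne_top]
    refine setLIntegral_mono_ae' isOpen_unitDisc.measurableSet (ae_of_all _ fun z hz => ?_)
    rw [← ENNReal.ofReal_mul (by norm_num)]
    exact ENNReal.ofReal_le_ofReal (hK z hz)
  rcases le_total ‖a‖ (1 / 2) with h | h
  · refine hbound (pointKernel (1 - ‖a‖) w) (fun z hz =>
      kernel_mul_mobius_weight_le_of_norm_le h hw1 (mem_unitDisc.mp hz)) ?_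
    refine (lintegral_pointKernel_le hδ hw).trans (ENNReal.ofReal_le_ofReal ?_)
    linarith [Real.pi_pos]
  · refine hbound (fun z => pointKernel (1 - ‖a‖) w z + pointKernel (1 - ‖a‖) a z)
      (fun z hz => ?_) ?_
    · have := kernel_mul_mobius_weight_le ha hw1 (mem_unitDisc.mp hz)
      have h1 := pointKernel_nonneg hδ.le w z
      have h2 := pointKernel_nonneg hδ.le a z
      linarith
    · simp_rw [ENNReal.ofReal_add (pointKernel_nonneg hδ.le w _) (pointKernel_nonneg hδ.le a _)]
      rw [lintegral_add_left (measurable_pointKernel _ _).ennreal_ofReal]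
      refine (add_le_add (lintegral_pointKernel_le hδ hw) (lintegral_pointKernel_le hδ h)).trans ?_
      rw [← ENNReal.ofReal_add (by positivity) (by positivity)]
      exact ENNReal.ofReal_le_ofReal (by linarith)

lemma exists_garsiaNorm_one_le : ∃ C : ℝ, 0 < C ∧ ∀ a : ℂ, 1 / 2 ≤ ‖a‖ → ‖a‖ < 1 →
    garsiaNorm 1 a ≤ ENNReal.ofReal (C * √(1 - ‖a‖)) := by
  refine ⟨√(36 * (16 * Real.pi)), by positivity, fun a ha ha1 => ?_⟩
  have h0 : 0 < 1 - ‖a‖ := sub_pos.mpr ha1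
  rw [← ENNReal.pow_le_pow_left_iff two_ne_zero, ← ENNReal.ofReal_pow (by positivity), mul_pow,
    Real.sq_sqrt (by positivity), Real.sq_sqrt h0.le, garsiaNorm_sq,
    show 36 * (16 * Real.pi) * (1 - ‖a‖) = 36 * (1 - ‖a‖) * (16 * Real.pi) by ring,
    ENNReal.ofReal_mul (by positivity)]
  refine le_trans ?_ (mul_le_mul_right (lintegral_pointKernel_le one_pos ha) _)
  rw [← lintegral_const_mul' _ _ ENNReal.ofReal_ne_top]
  refine setLIntegral_mono_ae' isOpen_unitDisc.measurableSet (ae_of_all _ fun z hz => ?_)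
  rw [← ENNReal.ofReal_mul (by positivity)]
  refine ENNReal.ofReal_le_ofReal ?_
  have hz' := mem_unitDisc.mp hz
  rw [one_sub_norm_mobius_sq ha1 hz', Pi.one_apply, norm_one, one_pow, one_mul]
  have hs := norm_one_sub_pos ha1 hz'
  have hs1 := one_sub_norm_le_norm_one_sub' (z := z) ha1
  have hs2 := norm_one_sub_le_two ha1 hz'
  unfold pointKernel
  set s := ‖1 - (starRingEnd ℂ) a * z‖
  have h1 : 1 - ‖a‖ ^ 2 ≤ 2 * (1 - ‖a‖) := by nlinarith [norm_nonneg a]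
  have h2 : 1 - ‖z‖ ^ 2 ≤ 2 * s := by nlinarith [norm_nonneg z]
  have h3 : 0 ≤ 1 - ‖z‖ ^ 2 := by nlinarith [norm_nonneg z]
  have h5 : 1 + s ≤ 3 := by linarith
  calc (1 - ‖a‖ ^ 2) * (1 - ‖z‖ ^ 2) / s ^ 2 ≤ (2 * (1 - ‖a‖)) * (2 * s) / s ^ 2 := by gcongr
    _ = 36 * (1 - ‖a‖) * (1 / (s * 3 ^ 2)) := by field_simp; norm_num
    _ ≤ 36 * (1 - ‖a‖) * (1 / (s * (1 + s) ^ 2)) := by gcongr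

/-! ### Comparison of the weighted norms at different points -/

lemma mobius_weight_zero (z : ℂ) : 1 - ‖mobius 0 z‖ ^ 2 = 1 - ‖z‖ ^ 2 := by simp [mobius]

lemma garsiaNorm_le_of_norm_le {a : ℂ} {r : ℝ} (hr : r < 1) (ha : ‖a‖ ≤ r) (h : ℂ → ℂ) :
    garsiaNorm h a ≤ ENNReal.ofReal (1 / (1 - r)) * garsiaNorm h 0 := by
  have hr' : 0 < 1 - r := sub_pos.mpr hr
  refine garsiaNorm_le_mul (by positivity) fun z hz => ?_
  have hz' := mem_unitDisc.mp hz
  have ha1 : ‖a‖ < 1 := ha.trans_lt hr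
  rw [mobius_weight_zero, one_sub_norm_mobius_sq ha1 hz']
  have hs := one_sub_norm_le_norm_one_sub (a := a) hz'
  have h1 : 1 - ‖a‖ ^ 2 ≤ 1 := by nlinarith [norm_nonneg a]
  have h3 : 0 ≤ 1 - ‖z‖ ^ 2 := by nlinarith [norm_nonneg z]
  have h4 : 1 - r ≤ ‖1 - (starRingEnd ℂ) a * z‖ := by linarith
  calc ‖h z‖ ^ 2 * ((1 - ‖a‖ ^ 2) * (1 - ‖z‖ ^ 2) / ‖1 - (starRingEnd ℂ) a * z‖ ^ 2)
      ≤ ‖h z‖ ^ 2 * (1 * (1 - ‖z‖ ^ 2) / (1 - r) ^ 2) := by gcongr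
    _ = (1 / (1 - r)) ^ 2 * (‖h z‖ ^ 2 * (1 - ‖z‖ ^ 2)) := by field_simp

lemma garsiaNorm_zero_lt_top {h : ℂ → ℂ} {a : ℂ} (ha : ‖a‖ < 1) (hh : garsiaNorm h a < ⊤) :
    garsiaNorm h 0 < ⊤ := by
  have hr' : 0 < 1 - ‖a‖ ^ 2 := by nlinarith [norm_nonneg a]
  have key : garsiaNorm h 0 ≤ ENNReal.ofReal (2 / √(1 - ‖a‖ ^ 2)) * garsiaNorm h a := by
    refine garsiaNorm_le_mul (by positivity) fun z hz => ?_
    have hz' := mem_unitDisc.mp hz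
    rw [mobius_weight_zero, one_sub_norm_mobius_sq ha hz', div_pow, Real.sq_sqrt hr'.le]
    have hs := norm_one_sub_pos ha hz'
    have hs2 := norm_one_sub_le_two ha hz'
    set s := ‖1 - (starRingEnd ℂ) a * z‖
    have h3 : 0 ≤ 1 - ‖z‖ ^ 2 := by nlinarith [norm_nonneg z]
    calc ‖h z‖ ^ 2 * (1 - ‖z‖ ^ 2)
        = s ^ 2 / (1 - ‖a‖ ^ 2) * (‖h z‖ ^ 2 * ((1 - ‖a‖ ^ 2) * (1 - ‖z‖ ^ 2) / s ^ 2)) := by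
          field_simp
      _ ≤ 2 ^ 2 / (1 - ‖a‖ ^ 2) * (‖h z‖ ^ 2 * ((1 - ‖a‖ ^ 2) * (1 - ‖z‖ ^ 2) / s ^ 2)) := by
          gcongr
  exact key.trans_lt (ENNReal.mul_lt_top ENNReal.ofReal_lt_top hh)

lemma garsiaNorm_lt_top_of_zero {h : ℂ → ℂ} {a : ℂ} (ha : ‖a‖ < 1) (hh : garsiaNorm h 0 < ⊤) :
    garsiaNorm h a < ⊤ :=
  (garsiaNorm_le_of_norm_le ha le_rfl h).trans_lt (ENNReal.mul_lt_top ENNReal.ofReal_lt_top hh)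

lemma garsiaNorm_one_zero_lt_top : garsiaNorm 1 0 < ⊤ := by
  obtain ⟨C, -, hC⟩ := exists_garsiaNorm_one_le
  refine garsiaNorm_zero_lt_top (a := 1 / 2) (by norm_num) ?_
  exact (hC (1 / 2) (by norm_num) (by norm_num)).trans_lt ENNReal.ofReal_lt_top

/-- A function that is small away from `w` and under control at the point `(1 - s) w` is small at
the origin. -/
lemma garsiaNorm_zero_le_of_far {h k : ℂ → ℂ} {w : ℂ} (hw : ‖w‖ < 1) {s η : ℝ} (hs : 0 < s)
    (hs1 : s ≤ 1) (hη : 0 ≤ η) (hh : ContinuousOn h unitDisc)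
    (H : ∀ z ∈ unitDisc, s ≤ ‖1 - (starRingEnd ℂ) w * z‖ → ‖h z‖ ≤ η * ‖k z‖) :
    garsiaNorm h 0 ≤ ENNReal.ofReal (2 * √s) * garsiaNorm h ((1 - s : ℝ) * w) +
      ENNReal.ofReal η * garsiaNorm k 0 := by
  refine garsiaNorm_le_add (by positivity) hη hh fun z hz => ?_
  have hz' := mem_unitDisc.mp hz
  have hnorm : ‖((1 - s : ℝ) : ℂ) * w‖ = (1 - s) * ‖w‖ := by
    rw [norm_mul, Complex.norm_real, Real.norm_of_nonneg (by linarith)]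
  have ha : ‖((1 - s : ℝ) : ℂ) * w‖ < 1 := by
    rw [hnorm]
    nlinarith [norm_nonneg w]
  have hz0 : 0 ≤ 1 - ‖z‖ ^ 2 := by nlinarith [norm_nonneg z]
  have hW := one_sub_norm_mobius_sq_nonneg ha hz'
  rw [mobius_weight_zero]
  rcases le_total s ‖1 - (starRingEnd ℂ) w * z‖ with hfar | hnear
  · have h1 : ‖h z‖ ^ 2 ≤ η ^ 2 * ‖k z‖ ^ 2 := by
      rw [← mul_pow]
      exact pow_le_pow_left₀ (norm_nonneg _) (H z hz hfar) 2
    have h2 : 0 ≤ (2 * √s) ^ 2 * (‖h z‖ ^ 2 * (1 - ‖mobius ((1 - s : ℝ) * w) z‖ ^ 2)) := by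
      positivity
    have h3 := mul_le_mul_of_nonneg_right h1 hz0
    linarith
  · have hd : ‖1 - (starRingEnd ℂ) (((1 - s : ℝ) : ℂ) * w) * z‖ ≤ 2 * s := by
      have : 1 - (starRingEnd ℂ) (((1 - s : ℝ) : ℂ) * w) * z =
          (1 - (starRingEnd ℂ) w * z) + (s : ℂ) * ((starRingEnd ℂ) w * z) := by
        rw [map_mul, Complex.conj_ofReal]
        push_cast
        ring
      rw [this]
      refine (norm_add_le _ _).trans ?_
      rw [norm_mul, norm_mul, RCLike.norm_conj, Complex.norm_real, Real.norm_of_nonneg hs.le]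
      have : ‖w‖ * ‖z‖ ≤ 1 := mul_le_one₀ hw.le (norm_nonneg _) hz'.le
      nlinarith
    have hpos := norm_one_sub_pos ha hz'
    have hwt : 1 - ‖z‖ ^ 2 ≤ (2 * √s) ^ 2 * (1 - ‖mobius ((1 - s : ℝ) * w) z‖ ^ 2) := by
      rw [one_sub_norm_mobius_sq ha hz', mul_pow, Real.sq_sqrt hs.le]
      have h1 : s ≤ 1 - ‖((1 - s : ℝ) : ℂ) * w‖ ^ 2 := by
        rw [hnorm]
        have : (1 - s) * ‖w‖ ≤ 1 - s := mul_le_of_le_one_right (by linarith) hw.le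
        nlinarith [mul_nonneg (sub_nonneg.mpr hs1) (norm_nonneg w)]
      calc 1 - ‖z‖ ^ 2 = 2 ^ 2 * s * (s * (1 - ‖z‖ ^ 2) / (2 * s) ^ 2) := by
            field_simp
        _ ≤ _ := by
            gcongr
            exact mul_nonneg (hs.le.trans h1) hz0
    have h3 := mul_le_mul_of_nonneg_left hwt (sq_nonneg ‖h z‖)
    have h4 : 0 ≤ η ^ 2 * (‖k z‖ ^ 2 * (1 - ‖z‖ ^ 2)) := by positivity
    linarith

/-! ### Logarithmic test functions -/

/-- The logarithmic factor `log (e / (1 - |w|²))`. -/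
def logWeight (w : ℂ) : ℝ := 1 - Real.log (1 - ‖w‖ ^ 2)

/-- The function `Log (e / (1 - conj(w) z))`. -/
def logKernel (w z : ℂ) : ℂ := 1 - Complex.log (1 - (starRingEnd ℂ) w * z)

/-- The test function `Log (e / (1 - conj(w) z))² / log (e / (1 - |w|²))`. -/
def logHump (w z : ℂ) : ℂ := logKernel w z ^ 2 / logWeight w

/-- The bound `log (e / s) + π` for `|Log (e / (1 - conj(w) z))|` when `s ≤ |1 - conj(w) z|`. -/
def logBound (s : ℝ) : ℝ := 1 - Real.log s + Real.pi

lemma one_sub_log_nonneg {s : ℝ} (hs : 0 < s) (hs2 : s ≤ 2) : 0 ≤ 1 - Real.log s := by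
  have h1 := Real.log_le_log hs hs2
  have h2 := Real.log_two_lt_d9
  linarith

lemma logBound_anti {s t : ℝ} (hs : 0 < s) (hst : s ≤ t) : logBound t ≤ logBound s := by
  have := Real.log_le_log hs hst
  unfold logBound
  linarith

lemma logBound_nonneg {s : ℝ} (hs : 0 < s) (hs2 : s ≤ 2) : 0 ≤ logBound s :=
  add_nonneg (one_sub_log_nonneg hs hs2) Real.pi_pos.le

lemma one_le_logWeight {w : ℂ} (hw : ‖w‖ < 1) : 1 ≤ logWeight w := by
  have : Real.log (1 - ‖w‖ ^ 2) ≤ 0 :=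
    Real.log_nonpos (by nlinarith [norm_nonneg w]) (by nlinarith [norm_nonneg w])
  unfold logWeight
  linarith

lemma log_exp_one_div_eq_logWeight {w : ℂ} (hw : ‖w‖ < 1) :
    Real.log (Real.exp 1 / (1 - ‖w‖ ^ 2)) = logWeight w := by
  have : 0 < 1 - ‖w‖ ^ 2 := by nlinarith [norm_nonneg w]
  rw [Real.log_div (Real.exp_pos 1).ne' this.ne', Real.log_exp, logWeight]

lemma one_sub_mem_slitPlane {w z : ℂ} (hw : ‖w‖ < 1) (hz : ‖z‖ < 1) :
    1 - (starRingEnd ℂ) w * z ∈ Complex.slitPlane := by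
  refine Or.inl ?_
  have h1 := Complex.re_le_norm ((starRingEnd ℂ) w * z)
  rw [norm_mul, RCLike.norm_conj] at h1
  have h2 : ‖w‖ * ‖z‖ < 1 := by nlinarith [norm_nonneg w, norm_nonneg z]
  rw [Complex.sub_re, Complex.one_re]
  linarith

lemma hasDerivAt_logKernel {w z : ℂ} (hw : ‖w‖ < 1) (hz : ‖z‖ < 1) :
    HasDerivAt (logKernel w) ((starRingEnd ℂ) w * (1 - (starRingEnd ℂ) w * z)⁻¹) z := by
  have h1 : HasDerivAt (fun z => 1 - (starRingEnd ℂ) w * z) (-((starRingEnd ℂ) w)) z := by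
    simpa using ((hasDerivAt_id z).const_mul ((starRingEnd ℂ) w)).const_sub 1
  convert! (h1.clog (one_sub_mem_slitPlane hw hz)).const_sub 1 using 1
  ring

lemma hasDerivAt_logHump {w z : ℂ} (hw : ‖w‖ < 1) (hz : ‖z‖ < 1) :
    HasDerivAt (logHump w) (2 * logKernel w z *
      ((starRingEnd ℂ) w * (1 - (starRingEnd ℂ) w * z)⁻¹) / logWeight w) z := by
  convert! ((hasDerivAt_logKernel hw hz).pow 2).div_const (logWeight w : ℂ) using 1
  simp

lemma differentiableOn_logHump {w : ℂ} (hw : ‖w‖ < 1) :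
    DifferentiableOn ℂ (logHump w) unitDisc := fun _ hz =>
  (hasDerivAt_logHump hw (mem_unitDisc.mp hz)).differentiableAt.differentiableWithinAt

lemma norm_logKernel_le {w z : ℂ} (hw : ‖w‖ < 1) (hz : ‖z‖ < 1) :
    ‖logKernel w z‖ ≤ logBound ‖1 - (starRingEnd ℂ) w * z‖ := by
  have h1 := Complex.norm_le_abs_re_add_abs_im (logKernel w z)
  have hre : (logKernel w z).re = 1 - Real.log ‖1 - (starRingEnd ℂ) w * z‖ := by
    simp [logKernel, Complex.log_re]
  have him : (logKernel w z).im = -(1 - (starRingEnd ℂ) w * z).arg := by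
    simp [logKernel, Complex.log_im]
  rw [hre, him, abs_neg, abs_of_nonneg
    (one_sub_log_nonneg (norm_one_sub_pos hw hz) (norm_one_sub_le_two hw hz))] at h1
  exact h1.trans (add_le_add_right (Complex.abs_arg_le_pi _) _)

lemma le_norm_logKernel (w z : ℂ) :
    1 - Real.log ‖1 - (starRingEnd ℂ) w * z‖ ≤ ‖logKernel w z‖ := by
  have hre : (logKernel w z).re = 1 - Real.log ‖1 - (starRingEnd ℂ) w * z‖ := by
    simp [logKernel, Complex.log_re]
  exact hre ▸ Complex.re_le_norm (logKernel w z)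

lemma logBound_le_logWeight {w z : ℂ} (hw : ‖w‖ < 1) (hz : ‖z‖ < 1) :
    logBound ‖1 - (starRingEnd ℂ) w * z‖ ≤ 6 * logWeight w := by
  have hx : 0 < 1 - ‖w‖ ^ 2 := by nlinarith [norm_nonneg w]
  have h1 : (1 - ‖w‖ ^ 2) / 2 ≤ ‖1 - (starRingEnd ℂ) w * z‖ :=
    le_trans (by nlinarith [norm_nonneg w]) (one_sub_norm_le_norm_one_sub hz)
  have h2 := Real.log_le_log (by positivity) h1
  rw [Real.log_div hx.ne' two_ne_zero] at h2
  have h3 := one_le_logWeight hw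
  unfold logBound
  unfold logWeight at *
  linarith [Real.pi_le_four, Real.log_two_lt_d9]

lemma norm_logHump {w : ℂ} (hw : ‖w‖ < 1) (z : ℂ) :
    ‖logHump w z‖ = ‖logKernel w z‖ ^ 2 / logWeight w := by
  rw [logHump, norm_div, norm_pow, Complex.norm_real,
    Real.norm_of_nonneg (zero_le_one.trans (one_le_logWeight hw))]

lemma norm_logHump_le_of_le {w z : ℂ} (hw : ‖w‖ < 1) (hz : ‖z‖ < 1) {s : ℝ} (hs : 0 < s)
    (h : s ≤ ‖1 - (starRingEnd ℂ) w * z‖) :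
    ‖logHump w z‖ ≤ logBound s ^ 2 / logWeight w := by
  have hL := one_le_logWeight hw
  have h1 := (norm_logKernel_le hw hz).trans (logBound_anti hs h)
  rw [norm_logHump hw]
  gcongr

lemma norm_logHump_le {w z : ℂ} (hw : ‖w‖ < 1) (hz : ‖z‖ < 1) :
    ‖logHump w z‖ ≤ 36 * logWeight w := by
  have hL := one_le_logWeight hw
  have h1 := (norm_logKernel_le hw hz).trans (logBound_le_logWeight hw hz)
  rw [norm_logHump hw, div_le_iff₀ (by linarith)]
  nlinarith [norm_nonneg (logKernel w z)]

lemma norm_deriv_logHump {w z : ℂ} (hw : ‖w‖ < 1) (hz : ‖z‖ < 1) :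
    ‖deriv (logHump w) z‖ ≤
      2 * ‖logKernel w z‖ / logWeight w * ‖(1 - (starRingEnd ℂ) w * z)⁻¹‖ := by
  have hL := one_le_logWeight hw
  rw [(hasDerivAt_logHump hw hz).deriv, norm_div, norm_mul, norm_mul, norm_mul, RCLike.norm_conj,
    Complex.norm_real, Real.norm_of_nonneg (by linarith), Complex.norm_ofNat]
  calc 2 * ‖logKernel w z‖ * (‖w‖ * ‖(1 - (starRingEnd ℂ) w * z)⁻¹‖) / logWeight w
      ≤ 2 * ‖logKernel w z‖ * (1 * ‖(1 - (starRingEnd ℂ) w * z)⁻¹‖) / logWeight w := by gcongr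
    _ = _ := by ring

lemma norm_deriv_logHump_le_of_le {w z : ℂ} (hw : ‖w‖ < 1) (hz : ‖z‖ < 1) {s : ℝ} (hs : 0 < s)
    (h : s ≤ ‖1 - (starRingEnd ℂ) w * z‖) :
    ‖deriv (logHump w) z‖ ≤ 2 * logBound s / s / logWeight w := by
  have hL := one_le_logWeight hw
  have h1 := (norm_logKernel_le hw hz).trans (logBound_anti hs h)
  have h0 : 0 ≤ logBound s := (norm_nonneg _).trans h1
  refine (norm_deriv_logHump hw hz).trans ?_
  rw [norm_inv]
  calc 2 * ‖logKernel w z‖ / logWeight w * ‖1 - (starRingEnd ℂ) w * z‖⁻¹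
      ≤ 2 * logBound s / logWeight w * s⁻¹ := by gcongr
    _ = _ := by ring

lemma norm_deriv_logHump_le {w z : ℂ} (hw : ‖w‖ < 1) (hz : ‖z‖ < 1) :
    ‖deriv (logHump w) z‖ ≤ 12 * ‖(1 - (starRingEnd ℂ) w * z)⁻¹‖ := by
  have hL := one_le_logWeight hw
  have h1 := (norm_logKernel_le hw hz).trans (logBound_le_logWeight hw hz)
  refine (norm_deriv_logHump hw hz).trans (mul_le_mul_of_nonneg_right ?_ (norm_nonneg _))
  rw [div_le_iff₀ (by linarith)]
  linarith

lemma le_norm_logHump {w z : ℂ} (hw : ‖w‖ < 1) (hz : ‖z‖ < 1)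
    (h : ‖1 - (starRingEnd ℂ) w * z‖ ≤ (1 - ‖w‖ ^ 2) ^ (1 / 4 : ℝ)) :
    logWeight w ≤ 16 * ‖logHump w z‖ := by
  have hL := one_le_logWeight hw
  have hx : 0 < 1 - ‖w‖ ^ 2 := by nlinarith [norm_nonneg w]
  have h1 := Real.log_le_log (norm_one_sub_pos hw hz) h
  rw [Real.log_rpow hx] at h1
  have h2 := le_norm_logKernel w z
  have h3 : logWeight w ≤ 4 * ‖logKernel w z‖ := by
    unfold logWeight
    linarith
  rw [norm_logHump hw, mul_div_assoc', le_div_iff₀ (by linarith)]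
  nlinarith

/-- Up to a small error, multiplication by the test function enlarges the norm at `w` by the
logarithmic factor. -/
lemma garsiaNorm_le_logHump_mul {w : ℂ} (hw : ‖w‖ < 1) {h : ℂ → ℂ}
    (hh : ContinuousOn h unitDisc) :
    garsiaNorm h w ≤ ENNReal.ofReal (16 / logWeight w) * garsiaNorm (logHump w * h) w +
      ENNReal.ofReal ((1 - ‖w‖ ^ 2) ^ (1 / 4 : ℝ)) * garsiaNorm h 0 := by
  have hL := one_le_logWeight hw
  have hx : 0 < 1 - ‖w‖ ^ 2 := by nlinarith [norm_nonneg w]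
  refine garsiaNorm_le_add (by positivity) (by positivity)
    ((differentiableOn_logHump hw).continuousOn.mul hh) fun z hz => ?_
  have hz' := mem_unitDisc.mp hz
  have hz0 : 0 ≤ 1 - ‖z‖ ^ 2 := by nlinarith [norm_nonneg z]
  have hW := one_sub_norm_mobius_sq_nonneg hw hz'
  rw [mobius_weight_zero]
  set t := (1 - ‖w‖ ^ 2) ^ (1 / 4 : ℝ) with ht
  have ht0 : 0 < t := by positivity
  have ht4 : 1 - ‖w‖ ^ 2 = t ^ 4 := by
    rw [ht, ← Real.rpow_mul_natCast hx.le]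
    norm_num
  rcases le_total ‖1 - (starRingEnd ℂ) w * z‖ t with hnear | hfar
  · have h1 : 1 ≤ 16 / logWeight w * ‖logHump w z‖ := by
      rw [div_mul_eq_mul_div, le_div_iff₀ (by linarith), one_mul]
      exact le_norm_logHump hw hz' hnear
    have h2 : ‖h z‖ ^ 2 ≤ (16 / logWeight w) ^ 2 * ‖(logHump w * h) z‖ ^ 2 := by
      rw [← mul_pow, Pi.mul_apply, norm_mul, ← mul_assoc]
      exact pow_le_pow_left₀ (norm_nonneg _) (le_mul_of_one_le_left (norm_nonneg _) h1) 2
    have h3 := mul_le_mul_of_nonneg_right h2 hW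
    have h4 : 0 ≤ t ^ 2 * (‖h z‖ ^ 2 * (1 - ‖z‖ ^ 2)) := by positivity
    linarith
  · have h1 : 1 - ‖mobius w z‖ ^ 2 ≤ t ^ 2 * (1 - ‖z‖ ^ 2) := by
      rw [one_sub_norm_mobius_sq hw hz', ht4]
      calc t ^ 4 * (1 - ‖z‖ ^ 2) / ‖1 - (starRingEnd ℂ) w * z‖ ^ 2
          ≤ t ^ 4 * (1 - ‖z‖ ^ 2) / t ^ 2 := by gcongr
        _ = t ^ 2 * (1 - ‖z‖ ^ 2) := by field_simp
    have h3 := mul_le_mul_of_nonneg_left h1 (sq_nonneg ‖h z‖)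
    have h4 : 0 ≤ (16 / logWeight w) ^ 2 *
        (‖(logHump w * h) z‖ ^ 2 * (1 - ‖mobius w z‖ ^ 2)) := by positivity
    linarith

/-! ### Normalized humps -/

lemma garsiaNorm_ofReal_mul {c : ℝ} (hc : 0 ≤ c) (f : ℂ → ℂ) (a : ℂ) :
    garsiaNorm (fun z => (c : ℂ) * f z) a = ENNReal.ofReal c * garsiaNorm f a := by
  have := eLpNorm_const_smul (c : ℂ) f 2 (garsiaMeasure a)
  rw [show ‖(c : ℂ)‖ₑ = ENNReal.ofReal c by
    rw [← ofReal_norm, Complex.norm_real, Real.norm_of_nonneg hc]] at this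
  exact this

/-- A bounded holomorphic function `B` in the little-oh classes, with `B` and `∫ B h` bounded by
`C` in `BMOA` and `∫ B h` bounded from below. -/
structure IsHump (h : ℂ → ℂ) (C : ℝ) (B : ℂ → ℂ) : Prop where
  differentiableOn : DifferentiableOn ℂ B unitDisc
  bounded : ∃ M : ℝ, ∀ z ∈ unitDisc, ‖B z‖ ≤ M
  deriv_le : ∀ a ∈ unitDisc, garsiaNorm (deriv B) a ≤ ENNReal.ofReal C
  mul_le : ∀ a ∈ unitDisc, garsiaNorm (B * h) a ≤ ENNReal.ofReal C
  exists_le : ∃ a ∈ unitDisc, ENNReal.ofReal (1 / 2) ≤ garsiaNorm (B * h) a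
  vanish : ∀ ε > 0, ∃ r < 1, ∀ a ∈ unitDisc, r < ‖a‖ →
    garsiaNorm (deriv B) a ≤ ENNReal.ofReal ε ∧ garsiaNorm (B * h) a ≤ ENNReal.ofReal ε

lemma exists_radius_of_eventually {p : ℝ → Prop} (hp : ∀ᶠ x in nhdsWithin (0 : ℝ) (Ioi 0), p x) :
    ∃ r < 1, ∀ w : ℂ, ‖w‖ < 1 → r < ‖w‖ → p (1 - ‖w‖ ^ 2) := by
  obtain ⟨u, hu, hs⟩ := (mem_nhdsGT_iff_exists_Ioo_subset).mp hp
  have hu' : (0 : ℝ) < u := hu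
  refine ⟨1 - u / 2, by linarith, fun w hw hr => hs ⟨?_, ?_⟩⟩
  · nlinarith [norm_nonneg w]
  · nlinarith [norm_nonneg w]

lemma exists_radius_logWeight_ge (M : ℝ) :
    ∃ r < 1, ∀ w : ℂ, ‖w‖ < 1 → r < ‖w‖ → M ≤ logWeight w := by
  refine exists_radius_of_eventually (p := fun x => M ≤ 1 - Real.log x) ?_
  filter_upwards [Real.tendsto_log_nhdsGT_zero.eventually_le_atBot (1 - M)] with x hx
  linarith

lemma exists_radius_logWeight_mul_le {δ : ℝ} (hδ : 0 < δ) :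
    ∃ r < 1, ∀ w : ℂ, ‖w‖ < 1 → r < ‖w‖ →
      logWeight w * (1 - ‖w‖ ^ 2) ^ (1 / 4 : ℝ) ≤ δ := by
  refine exists_radius_of_eventually (p := fun x => (1 - Real.log x) * x ^ (1 / 4 : ℝ) ≤ δ) ?_
  have h1 := tendsto_log_mul_rpow_nhdsGT_zero (r := 1 / 4) (by norm_num)
  have h2 : Tendsto (fun x : ℝ => x ^ (1 / 4 : ℝ)) (nhdsWithin 0 (Ioi 0)) (nhds 0) := by
    have := (Real.continuousAt_rpow_const 0 (1 / 4 : ℝ) (Or.inr (by norm_num))).tendsto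
    rw [Real.zero_rpow (by norm_num)] at this
    exact this.mono_left nhdsWithin_le_nhds
  have h3 := h2.sub h1
  rw [sub_zero] at h3
  filter_upwards [h3.eventually_le_const hδ] with x hx
  linarith

lemma exists_radius_le_garsiaNorm_logHump_mul {h : ℂ → ℂ} (hh : ContinuousOn h unitDisc) {K : ℝ}
    (hK : 0 < K) (hK0 : garsiaNorm h 0 ≤ ENNReal.ofReal K) {e : ℝ} (he : 0 < e) :
    ∃ r < 1, ∀ w : ℂ, ‖w‖ < 1 → r < ‖w‖ →
      ENNReal.ofReal e ≤ ENNReal.ofReal (logWeight w) * garsiaNorm h w →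
      ENNReal.ofReal (e / 32) ≤ garsiaNorm (logHump w * h) w := by
  obtain ⟨r, hr, H⟩ := exists_radius_logWeight_mul_le (δ := e / (2 * K)) (by positivity)
  refine ⟨r, hr, fun w hw hrw hew => ?_⟩
  have hL := one_le_logWeight hw
  have hL0 : 0 < logWeight w := by linarith
  have hx : 0 < 1 - ‖w‖ ^ 2 := by nlinarith [norm_nonneg w]
  by_cases htop : garsiaNorm (logHump w * h) w = ⊤
  · rw [htop]
    exact le_top
  have key := hew.trans (mul_le_mul_right (garsiaNorm_le_logHump_mul hw hh) _)
  have key2 := key.trans (mul_le_mul_right (add_le_add_right (mul_le_mul_right hK0 _) _) _)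
  rw [← ENNReal.ofReal_toReal htop] at key2 ⊢
  set n := (garsiaNorm (logHump w * h) w).toReal
  have hn : 0 ≤ n := ENNReal.toReal_nonneg
  rw [← ENNReal.ofReal_mul (by positivity), ← ENNReal.ofReal_mul (by positivity),
    ← ENNReal.ofReal_add (by positivity) (by positivity), ← ENNReal.ofReal_mul (by positivity),
    ENNReal.ofReal_le_ofReal_iff (by positivity)] at key2
  refine ENNReal.ofReal_le_ofReal ?_
  have h1 := mul_le_mul_of_nonneg_right (H w hw hrw) hK.le
  have h2 : e / (2 * K) * K = e / 2 := by field_simp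
  have h3 : logWeight w * (16 / logWeight w * n + (1 - ‖w‖ ^ 2) ^ (1 / 4 : ℝ) * K) =
      16 * n + logWeight w * (1 - ‖w‖ ^ 2) ^ (1 / 4 : ℝ) * K := by field_simp
  rw [h3] at key2
  linarith

lemma deriv_ofReal_mul (c : ℝ) (f : ℂ → ℂ) :
    deriv (fun z => (c : ℂ) * f z) = fun z => (c : ℂ) * deriv f z := by
  funext z
  exact deriv_const_mul_field _

lemma ofReal_mul_mul_eq (c : ℝ) (f h : ℂ → ℂ) :
    (fun z => (c : ℂ) * f z) * h = fun z => (c : ℂ) * (f * h) z := by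
  funext z
  simp only [Pi.mul_apply]
  ring

lemma exists_isHump_smul_logHump {h : ℂ → ℂ} {K : ℝ}
    (hbdd : ∀ a ∈ unitDisc, garsiaNorm h a ≤ ENNReal.ofReal K)
    (hvan : ∀ ε > 0, ∃ r < 1, ∀ a ∈ unitDisc, r < ‖a‖ → garsiaNorm h a ≤ ENNReal.ofReal ε)
    {c : ℝ} (hc : 0 < c) :
    ∃ C : ℝ, 0 < C ∧ ∀ w : ℂ, 1 / 2 ≤ ‖w‖ → ‖w‖ < 1 →
      ENNReal.ofReal c ≤ garsiaNorm (logHump w * h) w →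
      ∃ q : ℝ, c ≤ q ∧ IsHump h C (fun z => ((q⁻¹ : ℝ) : ℂ) * logHump w z) := by
  obtain ⟨C₀, hC₀, hker⟩ := exists_garsiaNorm_kernel_le
  obtain ⟨C₁, hC₁, hone⟩ := exists_garsiaNorm_one_le
  refine ⟨max (12 * C₀ / c) 1, by positivity, fun w hw2 hw hcw => ?_⟩
  have hL := one_le_logWeight hw
  have hL0 : 0 < logWeight w := by linarith
  have hmul : ∀ a ∈ unitDisc, garsiaNorm (logHump w * h) a ≤
      ENNReal.ofReal (36 * logWeight w) * garsiaNorm h a := by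
    intro a ha
    refine garsiaNorm_le_mul_of_norm_le (mem_unitDisc.mp ha) (by positivity) fun z hz => ?_
    rw [Pi.mul_apply, norm_mul]
    exact mul_le_mul_of_nonneg_right (norm_logHump_le hw (mem_unitDisc.mp hz)) (norm_nonneg _)
  set Q : ENNReal := ⨆ a : unitDisc, garsiaNorm (logHump w * h) a with hQ
  have hleQ : ∀ a ∈ unitDisc, garsiaNorm (logHump w * h) a ≤ Q := fun a ha =>
    le_iSup (fun a : unitDisc => garsiaNorm (logHump w * h) a) ⟨a, ha⟩
  have hQtop : Q ≠ ⊤ := by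
    refine ne_top_of_le_ne_top (b := ENNReal.ofReal (36 * logWeight w) * ENNReal.ofReal K)
      (ENNReal.mul_ne_top ENNReal.ofReal_ne_top ENNReal.ofReal_ne_top) (iSup_le fun a => ?_)
    exact (hmul a a.2).trans (mul_le_mul_right (hbdd a a.2) _)
  have hcQ : ENNReal.ofReal c ≤ Q := hcw.trans (hleQ w (mem_unitDisc.mpr hw))
  have hcq : c ≤ Q.toReal := (ENNReal.ofReal_le_iff_le_toReal hQtop).mp hcQ
  have hq : 0 < Q.toReal := hc.trans_le hcq
  have hqQ : ENNReal.ofReal Q.toReal = Q := ENNReal.ofReal_toReal hQtop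
  have hderiv : ∀ a, garsiaNorm (deriv fun z => ((Q.toReal⁻¹ : ℝ) : ℂ) * logHump w z) a =
      ENNReal.ofReal Q.toReal⁻¹ * garsiaNorm (deriv (logHump w)) a := by
    intro a
    rw [deriv_ofReal_mul, garsiaNorm_ofReal_mul (by positivity)]
  have hprod : ∀ a, garsiaNorm ((fun z => ((Q.toReal⁻¹ : ℝ) : ℂ) * logHump w z) * h) a =
      ENNReal.ofReal Q.toReal⁻¹ * garsiaNorm (logHump w * h) a := by
    intro a
    rw [ofReal_mul_mul_eq, garsiaNorm_ofReal_mul (by positivity)]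
  refine ⟨Q.toReal, hcq, ?_, ?_, ?_, ?_, ?_, ?_⟩
  · exact (differentiableOn_logHump hw).const_mul _
  · refine ⟨Q.toReal⁻¹ * (36 * logWeight w), fun z hz => ?_⟩
    rw [norm_mul, Complex.norm_real, Real.norm_of_nonneg (by positivity)]
    exact mul_le_mul_of_nonneg_left (norm_logHump_le hw (mem_unitDisc.mp hz)) (by positivity)
  · intro a ha
    rw [hderiv]
    have h1 : garsiaNorm (deriv (logHump w)) a ≤ ENNReal.ofReal 12 * ENNReal.ofReal C₀ := by
      refine (garsiaNorm_le_mul_of_norm_le (mem_unitDisc.mp ha) (by norm_num) fun z hz =>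
        norm_deriv_logHump_le hw (mem_unitDisc.mp hz)).trans ?_
      exact mul_le_mul_right (hker a w (mem_unitDisc.mp ha) hw2 hw) _
    refine (mul_le_mul_right h1 _).trans ?_
    rw [← ENNReal.ofReal_mul (by norm_num), ← ENNReal.ofReal_mul (by positivity)]
    refine ENNReal.ofReal_le_ofReal (le_trans ?_ (le_max_left _ _))
    rw [inv_mul_eq_div]
    gcongr
  · intro a ha
    rw [hprod]
    refine (mul_le_mul_right ((hleQ a ha).trans_eq hqQ.symm) _).trans ?_
    rw [← ENNReal.ofReal_mul (by positivity), inv_mul_cancel₀ hq.ne']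
    exact ENNReal.ofReal_le_ofReal (le_max_right _ _)
  · have hlt : ENNReal.ofReal (Q.toReal / 2) < ⨆ a : unitDisc, garsiaNorm (logHump w * h) a := by
      rw [← hQ, ← hqQ, ENNReal.ofReal_toReal hQtop, ENNReal.ofReal_lt_iff_lt_toReal (by positivity)
        hQtop]
      linarith
    obtain ⟨a, ha⟩ := lt_iSup_iff.mp hlt
    refine ⟨a, a.2, ?_⟩
    rw [hprod]
    refine le_trans ?_ (mul_le_mul_right ha.le _)
    rw [← ENNReal.ofReal_mul (by positivity)]
    refine ENNReal.ofReal_le_ofReal (le_of_eq ?_)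
    field_simp
  · intro ε hε
    obtain ⟨r₁, hr₁, H₁⟩ := hvan (ε / (Q.toReal⁻¹ * (36 * logWeight w))) (by positivity)
    have hw' : 0 < 1 - ‖w‖ := sub_pos.mpr hw
    set A := Q.toReal⁻¹ * (12 * (1 - ‖w‖)⁻¹ * C₁) with hA
    have hA0 : 0 < A := by positivity
    refine ⟨max r₁ (max (1 / 2) (1 - (ε / A) ^ 2)), ?_, fun a ha har => ⟨?_, ?_⟩⟩
    · refine max_lt hr₁ (max_lt (by norm_num) ?_)
      have : 0 < (ε / A) ^ 2 := by positivity
      linarith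
    · have ha' := mem_unitDisc.mp ha
      have h2 : 1 / 2 < ‖a‖ := (le_max_left _ _).trans_lt ((le_max_right _ _).trans_lt har)
      have h3 : 1 - (ε / A) ^ 2 < ‖a‖ :=
        (le_max_right _ _).trans_lt ((le_max_right _ _).trans_lt har)
      have h4 : √(1 - ‖a‖) ≤ ε / A := by
        rw [Real.sqrt_le_left (by positivity)]
        linarith
      have h1 : garsiaNorm (deriv (logHump w)) a ≤
          ENNReal.ofReal (12 * (1 - ‖w‖)⁻¹) * garsiaNorm 1 a := by
        refine garsiaNorm_le_mul_of_norm_le ha' (by positivity) fun z hz => ?_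
        refine (norm_deriv_logHump_le hw (mem_unitDisc.mp hz)).trans ?_
        have := one_sub_norm_le_norm_one_sub (a := w) (mem_unitDisc.mp hz)
        rw [Pi.one_apply, norm_one, mul_one, norm_inv]
        gcongr
      rw [hderiv]
      refine (mul_le_mul_right (h1.trans (mul_le_mul_right (hone a h2.le ha') _)) _).trans ?_
      rw [← ENNReal.ofReal_mul (by positivity), ← ENNReal.ofReal_mul (by positivity)]
      refine ENNReal.ofReal_le_ofReal ?_
      calc Q.toReal⁻¹ * (12 * (1 - ‖w‖)⁻¹ * (C₁ * √(1 - ‖a‖))) = A * √(1 - ‖a‖) := by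
            rw [hA]
            ring
        _ ≤ A * (ε / A) := by gcongr
        _ = ε := by field_simp
    · rw [hprod]
      refine (mul_le_mul_right ((hmul a ha).trans
        (mul_le_mul_right (H₁ a ha ((le_max_left _ _).trans_lt har)) _)) _).trans ?_
      rw [← ENNReal.ofReal_mul (by positivity), ← ENNReal.ofReal_mul (by positivity)]
      refine ENNReal.ofReal_le_ofReal (le_of_eq ?_)
      field_simp

lemma exists_isHump {h : ℂ → ℂ} (hh : ContinuousOn h unitDisc) {K : ℝ} (hK : 0 < K)
    (hbdd : ∀ a ∈ unitDisc, garsiaNorm h a ≤ ENNReal.ofReal K)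
    (hvan : ∀ ε > 0, ∃ r < 1, ∀ a ∈ unitDisc, r < ‖a‖ → garsiaNorm h a ≤ ENNReal.ofReal ε)
    {e : ℝ} (he : 0 < e)
    (hlog : ∀ r < 1, ∃ w ∈ unitDisc, r < ‖w‖ ∧
      ENNReal.ofReal e ≤ ENNReal.ofReal (logWeight w) * garsiaNorm h w) :
    ∃ C : ℝ, 0 < C ∧ ∀ r < 1, ∀ ε > 0, ∃ B, IsHump h C B ∧
      (∀ a ∈ unitDisc, ‖a‖ ≤ r → garsiaNorm (deriv B) a ≤ ENNReal.ofReal ε ∧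
        garsiaNorm (B * h) a ≤ ENNReal.ofReal ε) ∧
      ∀ z ∈ unitDisc, ‖z‖ ≤ r → ‖B z‖ ≤ ε := by
  have h0mem : (0 : ℂ) ∈ unitDisc := mem_unitDisc.mpr (by simp)
  have hK0 := hbdd 0 h0mem
  set c := e / 32 with hcdef
  have hc : 0 < c := by positivity
  obtain ⟨C, hC, hhump⟩ := exists_isHump_smul_logHump hbdd hvan hc
  obtain ⟨r₁, hr₁, H₁⟩ := exists_radius_le_garsiaNorm_logHump_mul hh hK hK0 he
  refine ⟨C, hC, fun r hr ε hε => ?_⟩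
  have hr' : 0 < 1 - r := sub_pos.mpr hr
  set ε' := (1 - r) * ε / 2 with hε'
  have hε'0 : 0 < ε' := by positivity
  set s := min 1 ((ε' / (2 * C)) ^ 2) with hs
  have hs0 : 0 < s := lt_min one_pos (by positivity)
  have hs1 : s ≤ 1 := min_le_left _ _
  have hsC : 2 * √s * C ≤ ε' := by
    have : √s ≤ ε' / (2 * C) := by
      rw [Real.sqrt_le_left (by positivity)]
      exact min_le_right _ _
    calc 2 * √s * C ≤ 2 * (ε' / (2 * C)) * C := by gcongr
      _ = ε' := by field_simp
  set K₁ := (garsiaNorm 1 0).toReal with hK₁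
  have hK₁' : garsiaNorm 1 0 = ENNReal.ofReal K₁ :=
    (ENNReal.ofReal_toReal garsiaNorm_one_zero_lt_top.ne).symm
  have hK₁0 : 0 ≤ K₁ := ENNReal.toReal_nonneg
  have hbs : 0 ≤ logBound s := logBound_nonneg hs0 (by linarith)
  set M₁ := c⁻¹ * (2 * logBound s / s) * K₁ / ε' with hM₁
  set M₂ := c⁻¹ * logBound s ^ 2 * K / ε' with hM₂
  set M₃ := c⁻¹ * logBound (1 - r) ^ 2 / ε with hM₃
  obtain ⟨r₂, hr₂, H₂⟩ := exists_radius_logWeight_ge (max M₁ (max M₂ M₃))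
  obtain ⟨w, hwD, hwr, hew⟩ := hlog (max (max r₁ r₂) (1 / 2))
    (max_lt (max_lt hr₁ hr₂) (by norm_num))
  have hw := mem_unitDisc.mp hwD
  obtain ⟨hwr', hw2⟩ := max_lt_iff.mp hwr
  obtain ⟨hwr₁, hwr₂⟩ := max_lt_iff.mp hwr'
  have hL := one_le_logWeight hw
  have hL0 : 0 < logWeight w := by linarith
  have hM := H₂ w hw hwr₂
  have hL₁ : M₁ ≤ logWeight w := (le_max_left _ _).trans hM
  have hL₂ : M₂ ≤ logWeight w := (le_max_left _ _).trans ((le_max_right _ _).trans hM)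
  have hL₃ : M₃ ≤ logWeight w := (le_max_right _ _).trans ((le_max_right _ _).trans hM)
  obtain ⟨q, hcq, hB⟩ := hhump w hw2.le hw (H₁ w hw hwr₁ hew)
  have hq : 0 < q := hc.trans_le hcq
  have hqc : q⁻¹ ≤ c⁻¹ := by gcongr
  have hsw : ((1 - s : ℝ) : ℂ) * w ∈ unitDisc := by
    rw [mem_unitDisc, norm_mul, Complex.norm_real, Real.norm_of_nonneg (by linarith)]
    nlinarith [norm_nonneg w]
  have hstep : ∀ f k : ℂ → ℂ, ∀ η κ : ℝ, 0 ≤ η → 0 ≤ κ → η * κ ≤ ε' → ContinuousOn f unitDisc →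
      (∀ a ∈ unitDisc, garsiaNorm f a ≤ ENNReal.ofReal C) →
      garsiaNorm k 0 ≤ ENNReal.ofReal κ →
      (∀ z ∈ unitDisc, s ≤ ‖1 - (starRingEnd ℂ) w * z‖ → ‖f z‖ ≤ η * ‖k z‖) →
      ∀ a ∈ unitDisc, ‖a‖ ≤ r → garsiaNorm f a ≤ ENNReal.ofReal ε := by
    intro f k η κ hη hκ hηκ hf hfC hk H a ha har
    refine (garsiaNorm_le_of_norm_le hr har f).trans ?_
    refine (mul_le_mul_right ((garsiaNorm_zero_le_of_far hw hs0 hs1 hη hf H).trans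
      (add_le_add (mul_le_mul_right (hfC _ hsw) _) (mul_le_mul_right hk _))) _).trans ?_
    rw [← ENNReal.ofReal_mul (by positivity), ← ENNReal.ofReal_mul (by positivity),
      ← ENNReal.ofReal_add (by positivity) (by positivity), ← ENNReal.ofReal_mul (by positivity)]
    refine ENNReal.ofReal_le_ofReal ?_
    calc 1 / (1 - r) * (2 * √s * C + η * κ) ≤ 1 / (1 - r) * (ε' + ε') := by gcongr
      _ = ε := by
        rw [hε']
        field_simp
        ring
  refine ⟨_, hB, fun a ha har => ⟨?_, ?_⟩, fun z hz hzr => ?_⟩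
  · refine hstep _ 1 (c⁻¹ * (2 * logBound s / s / logWeight w)) K₁ (by positivity) hK₁0 ?_
      (continuousOn_deriv_unitDisc hB.differentiableOn) hB.deriv_le hK₁'.le ?_ a ha har
    · rw [hM₁, div_le_iff₀ hε'0] at hL₁
      calc c⁻¹ * (2 * logBound s / s / logWeight w) * K₁
          = c⁻¹ * (2 * logBound s / s) * K₁ / logWeight w := by ring
        _ ≤ ε' := by rwa [div_le_iff₀ hL0, mul_comm ε']
    · intro z hz hsz
      rw [deriv_ofReal_mul, norm_mul, Complex.norm_real, Real.norm_of_nonneg (by positivity),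
        Pi.one_apply, norm_one, mul_one]
      exact mul_le_mul hqc (norm_deriv_logHump_le_of_le hw (mem_unitDisc.mp hz) hs0 hsz)
        (norm_nonneg _) (by positivity)
  · refine hstep _ h (c⁻¹ * (logBound s ^ 2 / logWeight w)) K (by positivity) hK.le ?_
      (hB.differentiableOn.continuousOn.mul hh) hB.mul_le hK0 ?_ a ha har
    · rw [hM₂, div_le_iff₀ hε'0] at hL₂
      calc c⁻¹ * (logBound s ^ 2 / logWeight w) * K
          = c⁻¹ * logBound s ^ 2 * K / logWeight w := by ring
        _ ≤ ε' := by rwa [div_le_iff₀ hL0, mul_comm ε']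
    · intro z hz hsz
      rw [Pi.mul_apply, norm_mul, norm_mul, Complex.norm_real, Real.norm_of_nonneg (by positivity)]
      refine mul_le_mul_of_nonneg_right ?_ (norm_nonneg _)
      exact mul_le_mul hqc (norm_logHump_le_of_le hw (mem_unitDisc.mp hz) hs0 hsz)
        (norm_nonneg _) (by positivity)
  · rw [norm_mul, Complex.norm_real, Real.norm_of_nonneg (by positivity)]
    have h1 : 1 - r ≤ ‖1 - (starRingEnd ℂ) w * z‖ :=
      le_trans (by linarith) (one_sub_norm_le_norm_one_sub' hw)
    rw [hM₃, div_le_iff₀ hε] at hL₃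
    calc q⁻¹ * ‖logHump w z‖ ≤ c⁻¹ * (logBound (1 - r) ^ 2 / logWeight w) :=
          mul_le_mul hqc (norm_logHump_le_of_le hw (mem_unitDisc.mp hz) hr' h1)
            (norm_nonneg _) (by positivity)
      _ = c⁻¹ * logBound (1 - r) ^ 2 / logWeight w := by ring
      _ ≤ ε := by rwa [div_le_iff₀ hL0, mul_comm ε]

/-! ### Superposition of humps -/

lemma exists_gliding_humps {h : ℂ → ℂ} {C : ℝ}
    (H : ∀ r < 1, ∀ ε > 0, ∃ B, IsHump h C B ∧
      (∀ a ∈ unitDisc, ‖a‖ ≤ r → garsiaNorm (deriv B) a ≤ ENNReal.ofReal ε ∧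
        garsiaNorm (B * h) a ≤ ENNReal.ofReal ε) ∧ ∀ z ∈ unitDisc, ‖z‖ ≤ r → ‖B z‖ ≤ ε)
    {ε : ℕ → ℝ} (hε : ∀ k, 0 < ε k) :
    ∃ (r : ℕ → ℝ) (B : ℕ → ℂ → ℂ), (∀ k, r k < 1) ∧ Monotone r ∧ Tendsto r atTop (nhds 1) ∧
      ∀ k, IsHump h C (B k) ∧
        (∀ a ∈ unitDisc, (‖a‖ ≤ r k ∨ r (k + 1) < ‖a‖) →
          garsiaNorm (deriv (B k)) a ≤ ENNReal.ofReal (ε k) ∧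
          garsiaNorm (B k * h) a ≤ ENNReal.ofReal (ε k)) ∧
        ∀ z ∈ unitDisc, ‖z‖ ≤ r k → ‖B k z‖ ≤ ε k := by
  have step : ∀ (k : ℕ) (r : {r : ℝ // r < 1}), ∃ p : (ℂ → ℂ) × {r : ℝ // r < 1},
      r.1 ≤ p.2.1 ∧ 1 - 1 / ((k : ℝ) + 1) ≤ p.2.1 ∧ IsHump h C p.1 ∧
        (∀ a ∈ unitDisc, (‖a‖ ≤ r.1 ∨ p.2.1 < ‖a‖) →
          garsiaNorm (deriv p.1) a ≤ ENNReal.ofReal (ε k) ∧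
          garsiaNorm (p.1 * h) a ≤ ENNReal.ofReal (ε k)) ∧
        ∀ z ∈ unitDisc, ‖z‖ ≤ r.1 → ‖p.1 z‖ ≤ ε k := by
    rintro k ⟨r, hr⟩
    obtain ⟨B, hB, hBr, hBz⟩ := H r hr (ε k) (hε k)
    obtain ⟨s, hs, hBs⟩ := hB.vanish (ε k) (hε k)
    have hk : 1 - 1 / ((k : ℝ) + 1) < 1 := by
      have : 0 < 1 / ((k : ℝ) + 1) := by positivity
      linarith
    refine ⟨⟨B, ⟨max r (max s (1 - 1 / ((k : ℝ) + 1))), max_lt hr (max_lt hs hk)⟩⟩,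
      le_max_left _ _, (le_max_right _ _).trans (le_max_right _ _), hB, ?_, hBz⟩
    rintro a ha (har | har)
    · exact hBr a ha har
    · exact hBs a ha (((le_max_left _ _).trans (le_max_right _ _)).trans_lt har)
  choose f hf1 hf2 hf3 hf4 hf5 using step
  let R : ℕ → {r : ℝ // r < 1} := fun n => Nat.rec ⟨0, one_pos⟩ (fun k r => (f k r).2) n
  have hR : ∀ k, R (k + 1) = (f k (R k)).2 := fun k => rfl
  refine ⟨fun k => (R k).1, fun k => (f k (R k)).1, fun k => (R k).2,
    monotone_nat_of_le_succ fun k => by rw [hR]; exact hf1 k _, ?_, fun k => ⟨hf3 k _, ?_, ?_⟩⟩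
  · rw [← tendsto_add_atTop_iff_nat 1]
    refine tendsto_of_tendsto_of_tendsto_of_le_of_le
      (g := fun k : ℕ => 1 - 1 / ((k : ℝ) + 1)) (h := fun _ => 1) ?_ tendsto_const_nhds
      (fun k => ?_) (fun k => (R (k + 1)).2.le)
    · simpa using tendsto_const_nhds.sub (tendsto_one_div_add_atTop_nhds_zero_nat (𝕜 := ℝ))
    · simp only [hR]
      exact hf2 k _
  · simp only [hR]
    exact hf4 k _
  · exact hf5 k _

lemma exists_forall_ne_le_or_lt {r : ℕ → ℝ} (hr : Monotone r) (x : ℝ) :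
    ∃ k, ∀ j ≠ k, x ≤ r j ∨ r (j + 1) < x := by
  by_cases hx : ∃ k, r k < x ∧ x ≤ r (k + 1)
  · obtain ⟨k, hk, hk'⟩ := hx
    refine ⟨k, fun j hj => ?_⟩
    rcases lt_or_gt_of_ne hj with h | h
    · exact .inr ((hr h).trans_lt hk)
    · exact .inl (hk'.trans (hr h))
  · push Not at hx
    exact ⟨0, fun j _ => (le_or_gt x (r j)).imp id (hx j)⟩

lemma tsum_le_of_forall_ne_le {N : ℕ → ENNReal} {k : ℕ} {c : ENNReal} {ε : ℕ → ENNReal}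
    (hk : N k ≤ c) (hN : ∀ j ≠ k, N j ≤ ε j) : ∑' j, N j ≤ c + ∑' j, ε j := by
  calc ∑' j, N j ≤ ∑' j, ((if j = k then c else 0) + ε j) := by
        refine ENNReal.tsum_le_tsum fun j => ?_
        by_cases hj : j = k
        · subst hj
          simpa using hk.trans le_self_add
        · simpa [hj] using hN j hj
    _ = c + ∑' j, ε j := by rw [ENNReal.tsum_add, tsum_ite_eq]

lemma tsum_ofReal_geometric :
    ∑' k : ℕ, ENNReal.ofReal (1 / 16 * (1 / 2) ^ k) = ENNReal.ofReal (1 / 8) := by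
  rw [← ENNReal.ofReal_tsum_of_nonneg (fun k => by positivity)
    (summable_geometric_two.mul_left _), tsum_mul_left, tsum_geometric_two]
  norm_num

lemma differentiableOn_tsum_of_gliding {B : ℕ → ℂ → ℂ} {r ε : ℕ → ℝ}
    (hr : Tendsto r atTop (nhds 1)) (hε : Summable ε)
    (hB : ∀ k, DifferentiableOn ℂ (B k) unitDisc)
    (hbdd : ∀ k, ∃ M, ∀ z ∈ unitDisc, ‖B k z‖ ≤ M)
    (hBr : ∀ k, ∀ z ∈ unitDisc, ‖z‖ ≤ r k → ‖B k z‖ ≤ ε k) :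
    DifferentiableOn ℂ (fun z => ∑' k, B k z) unitDisc ∧
      ∀ z ∈ unitDisc, HasSum (fun k => B k z) (∑' k, B k z) ∧
        HasSum (fun k => deriv (B k) z) (deriv (fun z => ∑' k, B k z) z) := by
  choose M hM using hbdd
  have key : ∀ z ∈ unitDisc, ∃ U, IsOpen U ∧ z ∈ U ∧ U ⊆ unitDisc ∧ ∃ u : ℕ → ℝ, Summable u ∧
      ∀ k, ∀ w ∈ U, ‖B k w‖ ≤ u k := by
    intro z hz
    obtain ⟨ρ, hρ, hρ1⟩ := exists_between (mem_unitDisc.1 hz)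
    have hsub : Metric.ball (0 : ℂ) ρ ⊆ unitDisc := Metric.ball_subset_ball hρ1.le
    refine ⟨Metric.ball 0 ρ, Metric.isOpen_ball, by simpa using hρ, hsub,
      fun k => if ρ ≤ r k then ε k else M k, ?_, fun k w hw => ?_⟩
    · refine (summable_congr_atTop ?_).1 hε
      filter_upwards [hr.eventually (eventually_ge_nhds hρ1)] with k hk
      simp [hk]
    · dsimp only
      split_ifs with h
      · exact hBr k w (hsub hw) ((by simpa using hw : ‖w‖ < ρ).le.trans h)
      · exact hM k w (hsub hw)
  refine ⟨fun z hz => ?_, fun z hz => ?_⟩ <;>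
    obtain ⟨U, hU, hzU, hUD, u, hu, hBu⟩ := key z hz
  · exact ((differentiableOn_tsum_of_summable_norm hu (fun k => (hB k).mono hUD) hU
      hBu).differentiableAt (hU.mem_nhds hzU)).differentiableWithinAt
  · exact ⟨(Summable.of_norm_bounded hu fun k => hBu k z hzU).hasSum,
      hasSum_deriv_of_summable_norm hu (fun k => (hB k).mono hUD) hU hBu hzU⟩

lemma exists_gliding_hump_sum {h : ℂ → ℂ} (hh : ContinuousOn h unitDisc) {C : ℝ}
    (H : ∀ r < 1, ∀ ε > 0, ∃ B, IsHump h C B ∧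
      (∀ a ∈ unitDisc, ‖a‖ ≤ r → garsiaNorm (deriv B) a ≤ ENNReal.ofReal ε ∧
        garsiaNorm (B * h) a ≤ ENNReal.ofReal ε) ∧ ∀ z ∈ unitDisc, ‖z‖ ≤ r → ‖B z‖ ≤ ε) :
    ∃ F : ℂ → ℂ, DifferentiableOn ℂ F unitDisc ∧
      ∃ K : ℝ, (∀ a ∈ unitDisc, garsiaNorm (deriv F) a ≤ ENNReal.ofReal K) ∧
        (∀ a ∈ unitDisc, garsiaNorm (F * h) a ≤ ENNReal.ofReal K) ∧
        ∀ r < 1, ∃ a ∈ unitDisc, r < ‖a‖ ∧ ENNReal.ofReal (1 / 4) ≤ garsiaNorm (F * h) a := by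
  have hε : ∀ k : ℕ, (0 : ℝ) < 1 / 16 * (1 / 2) ^ k := fun k => by positivity
  obtain ⟨r, B, -, hmono, hlim, hB⟩ := exists_gliding_humps H hε
  obtain ⟨hF, hsum⟩ := differentiableOn_tsum_of_gliding hlim (summable_geometric_two.mul_left _)
    (fun k => (hB k).1.differentiableOn) (fun k => (hB k).1.bounded) (fun k => (hB k).2.2)
  set F : ℂ → ℂ := fun z => ∑' k, B k z
  have hsumh : ∀ z ∈ unitDisc, HasSum (fun k => (B k * h) z) ((F * h) z) := fun z hz =>
    (hsum z hz).1.mul_right (h z)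
  have hBh : ∀ k, ContinuousOn (B k * h) unitDisc := fun k =>
    (hB k).1.differentiableOn.continuousOn.mul hh
  have hC0 : ENNReal.ofReal C + ENNReal.ofReal (1 / 8) ≤ ENNReal.ofReal (max C 0 + 1 / 8) := by
    rw [ENNReal.ofReal_add (le_max_right _ _) (by norm_num)]
    gcongr
    exact le_max_left _ _
  refine ⟨F, hF, max C 0 + 1 / 8, fun a ha => ?_, fun a ha => ?_, fun s hs => ?_⟩
  · obtain ⟨k, hk⟩ := exists_forall_ne_le_or_lt hmono ‖a‖
    refine ((garsiaNorm_le_tsum (fun j => continuousOn_deriv_unitDisc (hB j).1.differentiableOn)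
      (fun z hz => (hsum z hz).2) a).trans (tsum_le_of_forall_ne_le ((hB k).1.deriv_le a ha)
      fun j hj => ((hB j).2.1 a ha (hk j hj)).1)).trans ?_
    rwa [tsum_ofReal_geometric]
  · obtain ⟨k, hk⟩ := exists_forall_ne_le_or_lt hmono ‖a‖
    refine ((garsiaNorm_le_tsum hBh hsumh a).trans (tsum_le_of_forall_ne_le
      ((hB k).1.mul_le a ha) fun j hj => ((hB j).2.1 a ha (hk j hj)).2)).trans ?_
    rwa [tsum_ofReal_geometric]
  · obtain ⟨k, hk⟩ := (hlim.eventually (lt_mem_nhds hs)).exists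
    obtain ⟨a, ha, hpeak⟩ := (hB k).1.exists_le
    have hsmall : ¬ garsiaNorm (B k * h) a ≤ ENNReal.ofReal (1 / 16 * (1 / 2) ^ k) := by
      intro hcon
      have h1 := (ENNReal.ofReal_le_ofReal_iff (by positivity)).1 (hpeak.trans hcon)
      have h2 : ((1 : ℝ) / 2) ^ k ≤ 1 := pow_le_one₀ (by norm_num) (by norm_num)
      linarith
    have hkex : ¬ (‖a‖ ≤ r k ∨ r (k + 1) < ‖a‖) := fun hcon => hsmall ((hB k).2.1 a ha hcon).2
    push Not at hkex
    refine ⟨a, ha, hk.trans hkex.1, ?_⟩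
    have hother : ∀ j ≠ k, garsiaNorm (B j * h) a ≤ ENNReal.ofReal (1 / 16 * (1 / 2) ^ j) := by
      intro j hj
      refine ((hB j).2.1 a ha ?_).2
      rcases lt_or_gt_of_ne hj with hlt | hlt
      · exact .inr ((hmono hlt).trans_lt hkex.1)
      · exact .inl (hkex.2.trans (hmono hlt))
    let G : ℕ → ℂ → ℂ := Function.update (fun j => B j * h) k 0
    have hGk : G k = 0 := Function.update_self ..
    have hGj : ∀ j ≠ k, G j = B j * h := fun j hj => Function.update_of_ne hj ..
    have hG : ∀ z ∈ unitDisc, HasSum (fun j => G j z) ((F * h - B k * h) z) := by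
      intro z hz
      have h1 : (fun j => G j z) = Function.update (fun j => (B j * h) z) k 0 := by
        ext1 j
        by_cases hj : j = k
        · rw [hj, hGk, Function.update_self, Pi.zero_apply]
        · rw [hGj j hj, Function.update_of_ne hj]
      have h2 : (F * h - B k * h) z = 0 - (B k * h) z + (F * h) z := by
        rw [Pi.sub_apply]
        ring
      rw [h1, h2]
      exact (hsumh z hz).update k 0
    have hGc : ∀ j, ContinuousOn (G j) unitDisc := by
      intro j
      by_cases hj : j = k
      · rw [hj, hGk]
        exact continuousOn_const
      · rw [hGj j hj]
        exact hBh j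
    have hrest : garsiaNorm (F * h - B k * h) a ≤ ENNReal.ofReal (1 / 8) := by
      refine (garsiaNorm_le_tsum hGc hG a).trans ?_
      have h0 : garsiaNorm (G k) a ≤ 0 := by rw [hGk, garsiaNorm_zero]
      have h1 := tsum_le_of_forall_ne_le (N := fun j => garsiaNorm (G j) a) h0
        fun j hj => (congrArg (garsiaNorm · a) (hGj j hj)).trans_le (hother j hj)
      rwa [zero_add, tsum_ofReal_geometric] at h1
    have hFh : ContinuousOn (F * h) unitDisc := hF.continuousOn.mul hh
    have hadd := garsiaNorm_add_le hFh (hFh.sub (hBh k)).neg a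
    rw [show F * h + -(F * h - B k * h) = B k * h by ring,
      show garsiaNorm (-(F * h - B k * h)) a = garsiaNorm (F * h - B k * h) a from
        eLpNorm_neg _ _ _] at hadd
    by_contra! hcon
    refine absurd (hpeak.trans (hadd.trans (add_le_add hcon.le hrest))) (not_le.2 ?_)
    rw [← ENNReal.ofReal_add (by norm_num) (by norm_num)]
    exact (ENNReal.ofReal_lt_ofReal_iff (by norm_num)).2 (by norm_num)

/-! ### The Volterra operator -/

/-- A Volterra transform of a holomorphic symbol is a primitive of its integrand. -/
lemma hasDerivAt_volterra {g F : ℂ → ℂ} (hg : DifferentiableOn ℂ g unitDisc)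
    (hF : DifferentiableOn ℂ F unitDisc) {z : ℂ} (hz : z ∈ unitDisc) :
    HasDerivAt (volterra g F) (F z * deriv g z) z := by
  have hd : DifferentiableOn ℂ (fun z => F z * deriv g z) unitDisc :=
    hF.mul (hg.deriv isOpen_unitDisc)
  obtain ⟨P, hP⟩ := DifferentiableOn.isExactOn_ball hd
  have hball : ∀ w ∈ unitDisc, volterra g F w = P w - P 0 := by
    intro w hw
    have hmem : ∀ t ∈ uIcc (0 : ℝ) 1, (t : ℂ) * w ∈ unitDisc := by
      intro t ht
      rw [uIcc_of_le zero_le_one] at ht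
      rw [mem_unitDisc] at hw ⊢
      rw [norm_mul, Complex.norm_real, Real.norm_of_nonneg ht.1]
      exact (mul_le_of_le_one_left (norm_nonneg _) ht.2).trans_lt hw
    have hcont : ContinuousOn (fun t : ℝ => (t : ℂ) * w) (uIcc 0 1) := by fun_prop
    have hftc := intervalIntegral.integral_eq_sub_of_hasDerivAt
      (f := fun t : ℝ => P ((t : ℂ) * w))
      (f' := fun t : ℝ => F ((t : ℂ) * w) * deriv g ((t : ℂ) * w) * w) (a := 0) (b := 1)
      (fun t ht => by
        have h1 : HasDerivAt (fun t : ℝ => (t : ℂ) * w) w t := by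
          simpa using (Complex.ofRealCLM.hasDerivAt (x := t)).mul_const w
        exact (hP _ (hmem t ht)).comp t h1)
      ((((hd.continuousOn).comp hcont hmem).mul continuousOn_const).intervalIntegrable)
    rw [intervalIntegral.integral_mul_const] at hftc
    rw [volterra, mul_comm, hftc]
    simp
  refine ((hP z hz).sub_const (P 0)).congr_of_eventuallyEq ?_
  filter_upwards [isOpen_unitDisc.mem_nhds hz] with w hw using hball w hw

lemma bmoaSemi_eq_toReal_sq {f : ℂ → ℂ} (hf : DifferentiableOn ℂ f unitDisc) {a : ℂ}
    (ha : a ∈ unitDisc) :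
    bmoaSemi f a = Real.pi⁻¹ * (garsiaNorm (deriv f) a).toReal ^ 2 := by
  rw [bmoaSemi_eq (continuousOn_deriv_unitDisc hf) (mem_unitDisc.1 ha), ENNReal.toReal_pow]

lemma isBMOA_of_garsiaNorm_le {f : ℂ → ℂ} (hf : DifferentiableOn ℂ f unitDisc) {K : ℝ}
    (hK : ∀ a ∈ unitDisc, garsiaNorm (deriv f) a ≤ ENNReal.ofReal K) : IsBMOA f := by
  refine ⟨hf, Real.pi⁻¹ * (ENNReal.ofReal K).toReal ^ 2, fun a ha => ?_⟩
  rw [bmoaSemi_eq_toReal_sq hf ha]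
  have := ENNReal.toReal_mono ENNReal.ofReal_ne_top (hK a ha)
  gcongr

lemma not_isVMOA_of_le_garsiaNorm {f : ℂ → ℂ} {K c : ℝ} (hc : 0 < c)
    (hK : ∀ a ∈ unitDisc, garsiaNorm (deriv f) a ≤ ENNReal.ofReal K)
    (h : ∀ r < 1, ∃ a ∈ unitDisc, r < ‖a‖ ∧ ENNReal.ofReal c ≤ garsiaNorm (deriv f) a) :
    ¬ IsVMOA f := by
  rintro ⟨⟨hf, -⟩, hv⟩
  obtain ⟨r, hr, hra⟩ := hv (Real.pi⁻¹ * c ^ 2) (by positivity)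
  obtain ⟨a, ha, har, hca⟩ := h r hr
  refine absurd (hra a ha har) (not_lt.2 ?_)
  rw [bmoaSemi_eq_toReal_sq hf ha]
  have := (ENNReal.ofReal_le_iff_le_toReal
    ((hK a ha).trans_lt ENNReal.ofReal_lt_top).ne).1 hca
  gcongr

lemma garsiaNorm_le_of_bmoaSemi_le {f : ℂ → ℂ} (hf : DifferentiableOn ℂ f unitDisc) {a : ℂ}
    (ha : a ∈ unitDisc) (hfin : garsiaNorm (deriv f) a ≠ ⊤) {x y : ℝ} (hy : 0 ≤ y)
    (hx : bmoaSemi f a ≤ x) (hxy : x ≤ Real.pi⁻¹ * y ^ 2) :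
    garsiaNorm (deriv f) a ≤ ENNReal.ofReal y := by
  rw [bmoaSemi_eq_toReal_sq hf ha] at hx
  rw [ENNReal.le_ofReal_iff_toReal_le hfin hy]
  exact (sq_le_sq₀ ENNReal.toReal_nonneg hy).1
    (le_of_mul_le_mul_left (hx.trans hxy) (by positivity))

lemma garsiaNorm_ne_top_of_bmoaSemi_ne_zero {f : ℂ → ℂ} (hf : DifferentiableOn ℂ f unitDisc)
    {a : ℂ} (ha : a ∈ unitDisc) (h : bmoaSemi f a ≠ 0) {b : ℂ} (hb : b ∈ unitDisc) :
    garsiaNorm (deriv f) b ≠ ⊤ := by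
  have hfa : garsiaNorm (deriv f) a ≠ ⊤ := by
    intro htop
    simp [bmoaSemi_eq_toReal_sq hf ha, htop] at h
  exact (garsiaNorm_lt_top_of_zero (mem_unitDisc.1 hb)
    (garsiaNorm_zero_lt_top (mem_unitDisc.1 ha) hfa.lt_top)).ne

lemma exists_bmoa_of_isVMOA {g : ℂ → ℂ} (hg : IsVMOA g) (hgn : ¬ InVMOAlog g) :
    ∃ F : ℂ → ℂ, IsBMOA F ∧ IsBMOA (volterra g F) ∧ ¬ IsVMOA (volterra g F) := by
  obtain ⟨⟨hgd, M, hM⟩, hgv⟩ := hg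
  simp only [InVMOAlog, not_forall, not_exists, not_and, not_lt, exists_prop] at hgn
  obtain ⟨e, he, hlog⟩ := hgn
  have hfin : ∀ b ∈ unitDisc, garsiaNorm (deriv g) b ≠ ⊤ := by
    obtain ⟨a, ha, -, hea⟩ := hlog 0 one_pos
    refine fun b hb => garsiaNorm_ne_top_of_bmoaSemi_ne_zero hgd ha (fun h0 => ?_) hb
    rw [h0, mul_zero] at hea
    exact absurd he (not_lt.2 hea)
  have hpi := Real.pi_pos
  have hsq : ∀ x : ℝ, 0 ≤ x → x ≤ Real.pi⁻¹ * √(Real.pi * x) ^ 2 := by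
    intro x hx
    rw [Real.sq_sqrt (by positivity), inv_mul_cancel_left₀ hpi.ne']
  have hcont := continuousOn_deriv_unitDisc hgd
  obtain ⟨C, -, hC⟩ := exists_isHump hcont (K := √(Real.pi * max M 1)) (e := √(Real.pi * e))
    (by positivity)
    (fun a ha => garsiaNorm_le_of_bmoaSemi_le hgd ha (hfin a ha) (by positivity)
      ((hM a ha).trans (le_max_left _ _)) (hsq _ (by positivity)))
    (fun ε hε => by
      obtain ⟨r, hr, hra⟩ := hgv (Real.pi⁻¹ * ε ^ 2) (by positivity)
      exact ⟨r, hr, fun a ha har => garsiaNorm_le_of_bmoaSemi_le hgd ha (hfin a ha) hε.le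
        (hra a ha har).le le_rfl⟩)
    (by positivity)
    (fun r hr => by
      obtain ⟨w, hw, hrw, hew⟩ := hlog r hr
      refine ⟨w, hw, hrw, ?_⟩
      rw [log_exp_one_div_eq_logWeight (mem_unitDisc.1 hw), bmoaSemi_eq_toReal_sq hgd hw] at hew
      have hL : 0 ≤ logWeight w := zero_le_one.trans (one_le_logWeight (mem_unitDisc.1 hw))
      rw [← ENNReal.ofReal_toReal (hfin w hw), ← ENNReal.ofReal_mul hL]
      refine ENNReal.ofReal_le_ofReal (Real.sqrt_le_iff.2 ⟨by positivity, ?_⟩)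
      calc Real.pi * e ≤ Real.pi * (logWeight w ^ 2 *
            (Real.pi⁻¹ * (garsiaNorm (deriv g) w).toReal ^ 2)) := by gcongr
        _ = (logWeight w * (garsiaNorm (deriv g) w).toReal) ^ 2 := by field_simp)
  obtain ⟨F, hF, K, hFK, hFg, hpeak⟩ := exists_gliding_hump_sum hcont hC
  have hV : EqOn (deriv (volterra g F)) (F * deriv g) unitDisc := fun z hz =>
    (hasDerivAt_volterra hgd hF hz).deriv
  have hVd : DifferentiableOn ℂ (volterra g F) unitDisc := fun z hz =>
    (hasDerivAt_volterra hgd hF hz).differentiableAt.differentiableWithinAt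
  have hVK : ∀ a ∈ unitDisc, garsiaNorm (deriv (volterra g F)) a ≤ ENNReal.ofReal K :=
    fun a ha => (garsiaNorm_congr hV a).trans_le (hFg a ha)
  refine ⟨F, isBMOA_of_garsiaNorm_le hF hFK, isBMOA_of_garsiaNorm_le hVd hVK,
    not_isVMOA_of_le_garsiaNorm (c := 1 / 4) (by norm_num) hVK fun r hr => ?_⟩
  obtain ⟨a, ha, hra, h⟩ := hpeak r hr
  exact ⟨a, ha, hra, h.trans_eq (garsiaNorm_congr hV a).symm⟩

lemma bmoaSemi_volterra_one {g : ℂ → ℂ} (hg : DifferentiableOn ℂ g unitDisc) (a : ℂ) :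
    bmoaSemi (volterra g fun _ => 1) a = bmoaSemi g a := by
  rw [bmoaSemi, bmoaSemi]
  congr 1
  refine setIntegral_congr_fun isOpen_unitDisc.measurableSet fun z hz => ?_
  simp only [(hasDerivAt_volterra hg (differentiableOn_const 1) hz).deriv, one_mul]

/-- If `g ∈ BMOA \ VMOA_log`, then there exists `F ∈ BMOA` with
`T_g F ∈ BMOA \ VMOA`. -/
theorem exists_bmoa_with_volterra_in_bmoa_not_vmoa
    (g : ℂ → ℂ) (hg : IsBMOA g) (hgn : ¬ InVMOAlog g) :
    ∃ F : ℂ → ℂ, IsBMOA F ∧ IsBMOA (volterra g F) ∧ ¬ IsVMOA (volterra g F) := by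
  by_cases hgv : IsVMOA g
  · exact exists_bmoa_of_isVMOA hgv hgn
  · have hone : IsBMOA fun _ => 1 :=
      ⟨differentiableOn_const 1, 0, fun a _ => by simp [bmoaSemi]⟩
    have hV : IsBMOA (volterra g fun _ => 1) := by
      obtain ⟨hgd, C, hC⟩ := hg
      exact ⟨fun z hz => (hasDerivAt_volterra hgd hone.1
        hz).differentiableAt.differentiableWithinAt, C, fun a ha =>
          (bmoaSemi_volterra_one hgd a).trans_le (hC a ha)⟩
    refine ⟨fun _ => 1, hone, hV, fun hVv => hgv ⟨hg, fun ε hε => ?_⟩⟩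
    obtain ⟨r, hr, h⟩ := hVv.2 ε hε
    exact ⟨r, hr, fun a ha har => (bmoaSemi_volterra_one hg.1 a).symm.trans_lt (h a ha har)⟩
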